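/- arXiv:1701.01483 — 2 statements merged into one kernel-verified Lean document; each statement's English description precedes it below -/
import Mathlib

section
/- For every k and every ε > 0 there exists an explicit d = d(k,ε) such that: for every n, every t > 0, and every measurable f: ℝⁿ → [k], there exists a measurable h: ℝⁿ → [k] with E[h] = E[f], E[⟨h, P_t h⟩] ≥ E[⟨f, P_t f⟩] − ε, and W^{>d}[h] ≤ ε. -/
open MeasureTheory ProbabilityTheory MvPolynomial
open scoped Classical

noncomputable section

namespace GaussNS

/-- The standard Gaussian measure `γ` on `ι → ℝ`. -/
def gaussianPi (ι : Type*) [Fintype ι] : Measure (ι → ℝ) :=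
  Measure.pi fun _ => gaussianReal 0 1

/-- `Fin k` embedded as the standard basis vectors `e₁, …, e_k` of `ℝᵏ`. -/
def basisVec {k : ℕ} (i : Fin k) : Fin k → ℝ := fun j => if j = i then 1 else 0

/-- The Ornstein–Uhlenbeck operator `P_t` acting on scalar functions:
`(P_t f)(x) = ∫ f(e^{-t} x + √(1-e^{-2t}) y) dγ(y)`. -/
def ouOp {ι : Type*} [Fintype ι] (t : ℝ) (f : (ι → ℝ) → ℝ) (x : ι → ℝ) : ℝ :=
  ∫ y, f (fun i => Real.exp (-t) * x i + Real.sqrt (1 - Real.exp (-2 * t)) * y i) ∂gaussianPi ι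

/-- Noise stability `E⟨f, P_t f⟩` of a `[k]`-valued function on Gaussian space,
where `f` is identified with a basis-vector-valued function. -/
def noiseStab {ι : Type*} [Fintype ι] {k : ℕ} (t : ℝ) (f : (ι → ℝ) → Fin k) : ℝ :=
  ∫ x, ∑ j, basisVec (f x) j * ouOp t (fun y => basisVec (f y) j) x ∂gaussianPi ι

/-- The mean vector `E[f] ∈ Δ_k` of a `[k]`-valued function. -/
def gMean {ι : Type*} [Fintype ι] {k : ℕ} (f : (ι → ℝ) → Fin k) : Fin k → ℝ :=
  fun j => ∫ x, basisVec (f x) j ∂gaussianPi ι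

/-- The multivariate polynomial threshold function `PTF(p₁,…,p_k)`: value `j` if
`p j > 0` and `p i ≤ 0` for all `i ≠ j`, and the first index otherwise. -/
def ptf {ι : Type*} {k : ℕ} [NeZero k] (p : Fin k → MvPolynomial ι ℝ) (x : ι → ℝ) : Fin k :=
  if h : ∃ j, 0 < eval x (p j) ∧ ∀ i, i ≠ j → eval x (p i) ≤ 0 then h.choose else 0

/-- Collision set of a multivariate PTF: points where the number of strictly
positive `p j` is not exactly one. -/
def collisionSet {ι : Type*} {k : ℕ} (p : Fin k → MvPolynomial ι ℝ) : Set (ι → ℝ) :=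
  {x | ¬ ∃! j, 0 < eval x (p j)}

/-- Gaussian expectation of a polynomial. -/
def gExp {ι : Type*} [Fintype ι] (p : MvPolynomial ι ℝ) : ℝ :=
  ∫ x, eval x p ∂gaussianPi ι

/-- Gaussian variance of a polynomial. -/
def gVar {ι : Type*} [Fintype ι] (p : MvPolynomial ι ℝ) : ℝ :=
  (∫ x, (eval x p) ^ 2 ∂gaussianPi ι) - gExp p ^ 2

/-- A family `p₁,…,p_k` of polynomials is `(d, δ)`-balanced if each `p i` has Gaussian
variance `1` and `|E[p i]| ≤ (log (k d / δ))^{d/2}`. -/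
def balancedFam {ι : Type*} [Fintype ι] {k : ℕ} (d : ℕ) (δ : ℝ)
    (p : Fin k → MvPolynomial ι ℝ) : Prop :=
  ∀ i, gVar (p i) = 1 ∧ |gExp (p i)| ≤ Real.log ((k : ℝ) * d / δ) ^ ((d : ℝ) / 2)

/-- The normalized multivariate Hermite polynomial `H_S(x) = ∏ i, H_{S i}(x i)/√(S i)!`. -/
def hermiteH {ι : Type*} [Fintype ι] (S : ι → ℕ) (x : ι → ℝ) : ℝ :=
  ∏ i, (Polynomial.aeval (x i) (Polynomial.hermite (S i)) / Real.sqrt (Nat.factorial (S i)))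

/-- The Hermite coefficient `f̂(S) = E[f · H_S]`. -/
def hermCoeff {ι : Type*} [Fintype ι] (f : (ι → ℝ) → ℝ) (S : ι → ℕ) : ℝ :=
  ∫ x, f x * hermiteH S x ∂gaussianPi ι

/-- Hermite weight `W^{>d}[f] = Σ_{|S| > d} ‖f̂(S)‖²` of a vector-valued function. -/
def wAbove {ι : Type*} [Fintype ι] {k : ℕ} (d : ℕ) (f : (ι → ℝ) → Fin k → ℝ) : ℝ :=
  ∑' S : ι → ℕ, if d < ∑ i, S i then ∑ j, hermCoeff (fun x => f x j) S ^ 2 else 0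

/-- Hermite weight `W^{≥d}[f] = Σ_{|S| ≥ d} f̂(S)²` of a scalar function. -/
def wGE {ι : Type*} [Fintype ι] (d : ℕ) (f : (ι → ℝ) → ℝ) : ℝ :=
  ∑' S : ι → ℕ, if d ≤ ∑ i, S i then hermCoeff f S ^ 2 else 0

/-- Squared `L²(γ)` norm `Σ_{|S| = q} f̂(S)²` of the projection of `f` onto
the `q`-th Wiener chaos. -/
def chaosNormSq {ι : Type*} [Fintype ι] (q : ℕ) (f : (ι → ℝ) → ℝ) : ℝ :=
  ∑' S : ι → ℕ, if (∑ i, S i) = q then hermCoeff f S ^ 2 else 0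

/-- Frobenius norm of a tensor. -/
def frobNorm {α ι : Type*} [Fintype α] [Fintype ι] (T : (α → ι) → ℝ) : ℝ :=
  Real.sqrt (∑ t, T t ^ 2)

/-- Contraction product `f ⊗_r g` of an order-`p` and an order-`q` tensor along `r`
indices, presented as a tensor in the remaining `(p-r)` and `(q-r)` indices. -/
def contr {ι : Type*} [Fintype ι] {p q r : ℕ} (hp : r ≤ p) (hq : r ≤ q)
    (f : (Fin p → ι) → ℝ) (g : (Fin q → ι) → ℝ)
    (a : Fin (p - r) → ι) (b : Fin (q - r) → ι) : ℝ :=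
  ∑ z : Fin r → ι,
    f (fun i => Fin.append a z (Fin.cast (Nat.sub_add_cancel hp).symm i)) *
      g (fun i => Fin.append b z (Fin.cast (Nat.sub_add_cancel hq).symm i))

/-- `λ_{S,S̄}(A)`: the largest singular value of the matricization of `A` along the
partition `(S, S̄)` of its index set. -/
def lamPart {ι : Type*} [Fintype ι] {q : ℕ} (A : (Fin q → ι) → ℝ) (S : Finset (Fin q)) : ℝ :=
  ⨆ g : ({i // i ∈ S} → ι) → ℝ, ⨆ h : ({i // i ∉ S} → ι) → ℝ,
    (∑ t : Fin q → ι, A t * g (fun i => t i.1) * h (fun i => t i.1)) /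
      (frobNorm g * frobNorm h)

/-- `λ_max(A)`: maximum of `λ_{S,S̄}(A)` over nontrivial partitions `(S, S̄)`. -/
def lamMax {ι : Type*} [Fintype ι] {q : ℕ} (A : (Fin q → ι) → ℝ) : ℝ :=
  ⨆ S : {S : Finset (Fin q) // S ≠ ∅ ∧ S ≠ Finset.univ}, lamPart A S.1

/-- The symmetric tensor `A_q` with `p = Σ_q I_q(A_q)` for a multilinear polynomial
(in terms of its Hermite coefficients). -/
def chaosTensor {ι : Type*} [Fintype ι] [DecidableEq ι] (f : (ι → ℝ) → ℝ) (q : ℕ) :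
    (Fin q → ι) → ℝ :=
  fun t => if Function.Injective t then
      hermCoeff f (fun i => (Finset.univ.filter fun j => t j = i).card) / Real.sqrt (Nat.factorial q)
    else 0

/-- `λ_max(p) = max_{2 ≤ q ≤ deg p} λ_max(A_q)`. -/
def polyLamMax {ι : Type*} [Fintype ι] [DecidableEq ι] (p : MvPolynomial ι ℝ) : ℝ :=
  ⨆ q : {q : ℕ // 2 ≤ q ∧ q ≤ p.totalDegree}, lamMax (chaosTensor (fun x => eval x p) q.1)

/-- A polynomial is `δ`-eigenregular if `λ_max(p) ≤ δ √(Var p)`. -/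
def eigenregular {ι : Type*} [Fintype ι] [DecidableEq ι] (δ : ℝ) (p : MvPolynomial ι ℝ) : Prop :=
  polyLamMax p ≤ δ * Real.sqrt (gVar p)

/-- `p` lies in the `j`-th Wiener chaos `W^j`. -/
def inChaos {ι : Type*} [Fintype ι] (j : ℕ) (p : MvPolynomial ι ℝ) : Prop :=
  ∀ S : ι → ℕ, (∑ i, S i) ≠ j → hermCoeff (fun x => eval x p) S = 0

/-- Expectation over the uniform measure on the hypercube `{-1,1}ⁿ ≃ Boolⁿ`. -/
def cubeE {n : ℕ} (g : (Fin n → Bool) → ℝ) : ℝ := (∑ x, g x) / 2 ^ n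

/-- The Bonami–Beckner operator `T_ρ` on the hypercube. -/
def bbOp {n : ℕ} (ρ : ℝ) (g : (Fin n → Bool) → ℝ) (x : Fin n → Bool) : ℝ :=
  ∑ y : Fin n → Bool, (∏ i, if y i = x i then (1 + ρ) / 2 else (1 - ρ) / 2) * g y

/-- Noise stability `E⟨f, T_ρ f⟩` on the hypercube of a `[k]`-valued function. -/
def cubeStab {n k : ℕ} (ρ : ℝ) (f : (Fin n → Bool) → Fin k) : ℝ :=
  cubeE fun x => ∑ j, basisVec (f x) j * bbOp ρ (fun y => basisVec (f y) j) x

/-- Influence of coordinate `i`: `Inf_i(f) = E_z[Var(f_{z,-i})]`, computed as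
`E_x[‖f(x) - f(x^{⊕i})‖² / 4]`. -/
def influence {n k : ℕ} (i : Fin n) (f : (Fin n → Bool) → Fin k → ℝ) : ℝ :=
  cubeE fun x => (∑ j, (f x j - f (Function.update x i (!(x i))) j) ^ 2) / 4

/-- `g ∈ T_z(F)`: `g` is a measurable rounding of `F` by thresholding at `z`, i.e.
`⟨e_{g(x)}, F(x) - z⟩ ≥ F_i(x) - z_i` for all `i` and `x`. -/
def memTz {ι : Type*} [Fintype ι] {k : ℕ} (z : Fin k → ℝ) (F : (ι → ℝ) → Fin k → ℝ)
    (g : (ι → ℝ) → Fin k) : Prop :=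
  Measurable (fun x => basisVec (g x)) ∧ ∀ x i, F x i - z i ≤ F x (g x) - z (g x)

/-- `V` bounds the Gaussian total variation `E[|∇f|]` of `f`, characterized
distributionally: for every `C¹` compactly supported vector field `φ` with `‖φ‖ ≤ 1`,
`∫ f · (div φ - ⟨x, φ⟩) dγ ≤ V`.  The least such `V` is `E[|∇f|]`. -/
def gaussTV {n : ℕ} (f : (Fin n → ℝ) → ℝ) (V : ℝ) : Prop :=
  ∀ φ : (Fin n → ℝ) → (Fin n → ℝ), ContDiff ℝ 1 φ → HasCompactSupport φ →
    (∀ x, Real.sqrt (∑ i, φ x i ^ 2) ≤ 1) →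
    (∫ x, f x * ((∑ i, fderiv ℝ (fun y => φ y i) x (Pi.single i 1)) - ∑ i, x i * φ x i)
        ∂gaussianPi (Fin n)) ≤ V

/-- Evaluation of a polynomial at the noisy point `e^{-t} x + √(1-e^{-2t}) y`. -/
def corrEval {m : ℕ} (t : ℝ) (p : MvPolynomial (Fin m) ℝ)
    (xy : (Fin m → ℝ) × (Fin m → ℝ)) : ℝ :=
  eval (fun i => Real.exp (-t) * xy.1 i + Real.sqrt (1 - Real.exp (-2 * t)) * xy.2 i) p

end GaussNS

open GaussNS

instance isProbabilityMeasure_gaussianPi (ι : Type*) [Fintype ι] :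
    IsProbabilityMeasure (gaussianPi ι) := by
  unfold gaussianPi; infer_instance

instance isGaussian_gaussianPi (ι : Type*) [Fintype ι] : IsGaussian (gaussianPi ι) := by
  have h : gaussianPi ι =
      (stdGaussian (EuclideanSpace ℝ ι)).map (EuclideanSpace.equiv ι ℝ) := by
    rw [← map_pi_eq_stdGaussian, Measure.map_map (by fun_prop) (by fun_prop)]
    exact Measure.map_id.symm
  rw [h]
  infer_instance

lemma measurePreserving_neg_gaussianPi (ι : Type*) [Fintype ι] :
    MeasurePreserving (fun x : ι → ℝ => -x) (gaussianPi ι) (gaussianPi ι) := by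
  refine measurePreserving_pi (f := fun _ x => -x) _ _ fun _ => ⟨measurable_neg, ?_⟩
  simp [gaussianReal_map_neg]

lemma integral_dual_gaussianPi {ι : Type*} [Fintype ι] (L : StrongDual ℝ (ι → ℝ)) :
    ∫ x, L x ∂gaussianPi ι = 0 := by
  have h := (measurePreserving_neg_gaussianPi ι).integral_comp
    (MeasurableEquiv.neg (ι → ℝ)).measurableEmbedding (fun x => L x)
  simp only [map_neg, integral_neg] at h
  linarith

lemma measurePreserving_rotation {ι : Type*} [Fintype ι] {a b : ℝ} (hb : 0 ≤ b)
    (hab : a ^ 2 + b ^ 2 = 1) :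
    MeasurePreserving (fun p : (ι → ℝ) × (ι → ℝ) => (a • p.1 + b • p.2, -b • p.1 + a • p.2))
      ((gaussianPi ι).prod (gaussianPi ι)) ((gaussianPi ι).prod (gaussianPi ι)) := by
  have h := IsGaussian.map_rotation_eq_self_of_forall_strongDual_eq_zero
    (integral_dual_gaussianPi (ι := ι)) (Real.arccos a)
  have hc : Real.cos (Real.arccos a) = a := Real.cos_arccos (by nlinarith) (by nlinarith)
  have hs : Real.sin (Real.arccos a) = b := by
    rw [Real.sin_arccos, ← hab, add_sub_cancel_left, Real.sqrt_sq hb]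
  refine ⟨by fun_prop, ?_⟩
  convert h using 2
  ext p : 1
  rw [ContinuousLinearMap.rotation_apply, hc, hs]

lemma measurePreserving_mix {ι : Type*} [Fintype ι] {a b : ℝ} (hb : 0 ≤ b)
    (hab : a ^ 2 + b ^ 2 = 1) :
    MeasurePreserving (fun p : (ι → ℝ) × (ι → ℝ) => a • p.1 + b • p.2)
      ((gaussianPi ι).prod (gaussianPi ι)) (gaussianPi ι) :=
  measurePreserving_fst.comp (measurePreserving_rotation hb hab)

lemma measurePreserving_reflection {ι : Type*} [Fintype ι] {a b : ℝ} (hb : 0 ≤ b)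
    (hab : a ^ 2 + b ^ 2 = 1) :
    MeasurePreserving (fun p : (ι → ℝ) × (ι → ℝ) => (a • p.1 + b • p.2, b • p.1 - a • p.2))
      ((gaussianPi ι).prod (gaussianPi ι)) ((gaussianPi ι).prod (gaussianPi ι)) := by
  have h := ((MeasurePreserving.id (gaussianPi ι)).prod (measurePreserving_neg_gaussianPi ι)).comp
    (measurePreserving_rotation hb hab)
  convert h using 1
  ext p : 1
  simp [sub_eq_add_neg, add_comm]

/-- The noisy point `e^{-t} x + √(1-e^{-2t}) y`. -/
def mix {ι : Type*} (t : ℝ) (x y : ι → ℝ) : ι → ℝ :=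
  Real.exp (-t) • x + Real.sqrt (1 - Real.exp (-2 * t)) • y

lemma exp_sq_add_sqrt_sq {t : ℝ} (ht : 0 ≤ t) :
    Real.exp (-t) ^ 2 + Real.sqrt (1 - Real.exp (-2 * t)) ^ 2 = 1 := by
  have h : Real.exp (-2 * t) ≤ 1 := Real.exp_le_one_iff.2 (by linarith)
  rw [Real.sq_sqrt (by linarith), ← Real.exp_nat_mul]
  push_cast
  rw [show (2 : ℝ) * -t = -2 * t by ring]
  ring

lemma ouOp_eq {ι : Type*} [Fintype ι] (t : ℝ) (f : (ι → ℝ) → ℝ) (x : ι → ℝ) :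
    ouOp t f x = ∫ y, f (mix t x y) ∂gaussianPi ι := rfl

@[fun_prop]
lemma measurable_mix {ι : Type*} (t : ℝ) :
    Measurable fun p : (ι → ℝ) × (ι → ℝ) => mix t p.1 p.2 := by
  unfold mix; fun_prop

lemma measurePreserving_mix_exp {ι : Type*} [Fintype ι] {t : ℝ} (ht : 0 ≤ t) :
    MeasurePreserving (fun p : (ι → ℝ) × (ι → ℝ) => mix t p.1 p.2)
      ((gaussianPi ι).prod (gaussianPi ι)) (gaussianPi ι) :=
  measurePreserving_mix (Real.sqrt_nonneg _) (exp_sq_add_sqrt_sq ht)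

/-- Bounded measurable real functions. -/
structure BddMeas {α : Type*} [MeasurableSpace α] (f : α → ℝ) : Prop where
  measurable : Measurable f
  bdd : ∃ C, ∀ x, |f x| ≤ C

namespace BddMeas

variable {α β : Type*} [MeasurableSpace α] [MeasurableSpace β] {f g : α → ℝ}

lemma integrable (hf : BddMeas f) (μ : Measure α) [IsFiniteMeasure μ] : Integrable f μ := by
  obtain ⟨C, hC⟩ := hf.bdd
  exact Integrable.of_bound hf.measurable.aestronglyMeasurable C (Filter.Eventually.of_forall hC)

lemma memLp (hf : BddMeas f) (μ : Measure α) [IsFiniteMeasure μ] : MemLp f 2 μ := by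
  obtain ⟨C, hC⟩ := hf.bdd
  exact MemLp.of_bound hf.measurable.aestronglyMeasurable C (Filter.Eventually.of_forall hC)

lemma mul (hf : BddMeas f) (hg : BddMeas g) : BddMeas fun x => f x * g x := by
  obtain ⟨C, hC⟩ := hf.bdd
  obtain ⟨D, hD⟩ := hg.bdd
  refine ⟨hf.measurable.mul hg.measurable, C * D, fun x => ?_⟩
  rw [abs_mul]
  exact mul_le_mul (hC x) (hD x) (abs_nonneg _) ((abs_nonneg _).trans (hC x))

lemma sub (hf : BddMeas f) (hg : BddMeas g) : BddMeas fun x => f x - g x := by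
  obtain ⟨C, hC⟩ := hf.bdd
  obtain ⟨D, hD⟩ := hg.bdd
  exact ⟨hf.measurable.sub hg.measurable, C + D, fun x =>
    (abs_sub _ _).trans (add_le_add (hC x) (hD x))⟩

lemma comp (hf : BddMeas f) {φ : β → α} (hφ : Measurable φ) : BddMeas fun x => f (φ x) := by
  obtain ⟨C, hC⟩ := hf.bdd
  exact ⟨hf.measurable.comp hφ, C, fun x => hC _⟩

end BddMeas

lemma mix_reflection {ι : Type*} {t : ℝ} (ht : 0 ≤ t) (x y : ι → ℝ) :
    mix t (Real.exp (-t) • x + Real.sqrt (1 - Real.exp (-2 * t)) • y)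
      (Real.sqrt (1 - Real.exp (-2 * t)) • x - Real.exp (-t) • y) = x := by
  have h := exp_sq_add_sqrt_sq ht
  ext i
  simp only [mix, Pi.add_apply, Pi.smul_apply, Pi.sub_apply, smul_eq_mul]
  linear_combination x i * h

lemma BddMeas.comp_mix {ι : Type*} {f : (ι → ℝ) → ℝ} (hf : BddMeas f) (t : ℝ) (x : ι → ℝ) :
    BddMeas fun y => f (mix t x y) :=
  hf.comp (by unfold mix; fun_prop)

section OU

variable {ι : Type*} [Fintype ι] {f g : (ι → ℝ) → ℝ} {s t : ℝ}

lemma BddMeas.ouOp (hf : BddMeas f) (t : ℝ) : BddMeas (ouOp t f) := by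
  obtain ⟨C, hC⟩ := hf.bdd
  refine ⟨?_, C, fun x => ?_⟩
  · have h : StronglyMeasurable fun p : (ι → ℝ) × (ι → ℝ) => f (mix t p.1 p.2) :=
      (hf.measurable.comp (measurable_mix t)).stronglyMeasurable
    exact h.integral_prod_right'.measurable
  · rw [ouOp_eq]
    simpa using norm_integral_le_of_norm_le_const (μ := gaussianPi ι)
      (f := fun y => f (mix t x y)) (C := C) (Filter.Eventually.of_forall fun y => hC _)

lemma ouOp_sub (hf : BddMeas f) (hg : BddMeas g) (t : ℝ) (x : ι → ℝ) :
    ouOp t (fun y => f y - g y) x = ouOp t f x - ouOp t g x :=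
  integral_sub ((hf.comp_mix t x).integrable _) ((hg.comp_mix t x).integrable _)

lemma integral_mul_ouOp (hf : BddMeas f) (hg : BddMeas g) (t : ℝ) :
    ∫ x, f x * ouOp t g x ∂gaussianPi ι =
      ∫ p, f p.1 * g (mix t p.1 p.2) ∂(gaussianPi ι).prod (gaussianPi ι) := by
  rw [integral_prod _ (((hf.comp measurable_fst).mul (hg.comp (measurable_mix t))).integrable _)]
  simp only [ouOp_eq, integral_const_mul]

lemma integral_pair_symm (ht : 0 ≤ t) {F : (ι → ℝ) → (ι → ℝ) → ℝ}
    (hF : Measurable (Function.uncurry F)) :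
    ∫ p, F p.1 (mix t p.1 p.2) ∂(gaussianPi ι).prod (gaussianPi ι) =
      ∫ p, F (mix t p.1 p.2) p.1 ∂(gaussianPi ι).prod (gaussianPi ι) := by
  have h := measurePreserving_reflection (ι := ι) (Real.sqrt_nonneg _) (exp_sq_add_sqrt_sq ht)
  have hm : Measurable fun p : (ι → ℝ) × (ι → ℝ) => F p.1 (mix t p.1 p.2) :=
    hF.comp (measurable_fst.prodMk (measurable_mix t))
  conv_lhs => rw [← h.map_eq]
  rw [integral_map h.measurable.aemeasurable hm.aestronglyMeasurable]
  simp only [mix_reflection ht]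
  rfl

lemma integral_ouOp_symm (hf : BddMeas f) (hg : BddMeas g) (ht : 0 ≤ t) :
    ∫ x, f x * ouOp t g x ∂gaussianPi ι = ∫ x, ouOp t f x * g x ∂gaussianPi ι := by
  simp only [mul_comm (ouOp t f _)]
  rw [integral_mul_ouOp hf hg, integral_mul_ouOp hg hf,
    integral_pair_symm ht (F := fun x y => f x * g y)
      ((hf.measurable.comp measurable_fst).mul (hg.measurable.comp measurable_snd))]
  simp only [mul_comm]

lemma ouOp_ouOp (hf : BddMeas f) (hs : 0 ≤ s) (ht : 0 ≤ t) (x : ι → ℝ) :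
    ouOp s (ouOp t f) x = ouOp (s + t) f x := by
  set as := Real.exp (-s) with has
  set bs := Real.sqrt (1 - Real.exp (-2 * s)) with hbs
  set at' := Real.exp (-t) with hat
  set bt := Real.sqrt (1 - Real.exp (-2 * t)) with hbt
  set c := Real.sqrt (1 - Real.exp (-2 * (s + t))) with hc
  have hs1 : as ^ 2 + bs ^ 2 = 1 := exp_sq_add_sqrt_sq hs
  have ht1 : at' ^ 2 + bt ^ 2 = 1 := exp_sq_add_sqrt_sq ht
  have hst : Real.exp (-(s + t)) = as * at' := by rw [has, hat, ← Real.exp_add]; ring_nf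
  have hc1 : (as * at') ^ 2 + c ^ 2 = 1 := hst ▸ exp_sq_add_sqrt_sq (add_nonneg hs ht)
  have hc2 : c ^ 2 = (at' * bs) ^ 2 + bt ^ 2 := by nlinarith
  have hbs0 : 0 ≤ bs := Real.sqrt_nonneg _
  have hbt0 : 0 ≤ bt := Real.sqrt_nonneg _
  have hc0 : 0 ≤ c := Real.sqrt_nonneg _
  obtain ⟨u, v, hv, huv, hu', hv'⟩ : ∃ u v : ℝ, 0 ≤ v ∧ u ^ 2 + v ^ 2 = 1 ∧
      at' * bs = c * u ∧ bt = c * v := by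
    rcases hc0.eq_or_lt with h | h
    · refine ⟨1, 0, le_rfl, by norm_num, ?_, ?_⟩ <;> rw [← h] at hc2 ⊢ <;> nlinarith
    · refine ⟨at' * bs / c, bt / c, by positivity, ?_, by field_simp, by field_simp⟩
      field_simp
      linarith
  have hm := measurePreserving_mix (ι := ι) hv huv
  have hg : BddMeas fun p : (ι → ℝ) × (ι → ℝ) => f (mix t (mix s x p.1) p.2) :=
    hf.comp (by unfold mix; fun_prop)
  have hg' : Measurable fun y => f (mix (s + t) x y) := (hf.comp_mix (s + t) x).measurable
  calc ouOp s (ouOp t f) x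
      = ∫ p, f (mix t (mix s x p.1) p.2) ∂(gaussianPi ι).prod (gaussianPi ι) := by
        rw [integral_prod _ (hg.integrable _)]; rfl
    _ = ∫ p, f (mix (s + t) x (u • p.1 + v • p.2)) ∂(gaussianPi ι).prod (gaussianPi ι) := by
        congr 1
        ext p
        congr 1
        ext i
        simp only [mix, Pi.add_apply, Pi.smul_apply, smul_eq_mul, hst, ← has, ← hbs, ← hat,
          ← hbt, ← hc]
        linear_combination p.1 i * hu' + p.2 i * hv'
    _ = ouOp (s + t) f x := by
        rw [ouOp_eq]
        conv_rhs => rw [← hm.map_eq]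
        rw [integral_map hm.measurable.aemeasurable hg'.aestronglyMeasurable]

lemma integral_mul_ouOp_ouOp (hf : BddMeas f) (hg : BddMeas g) (hs : 0 ≤ s) (ht : 0 ≤ t) :
    ∫ x, ouOp s f x * ouOp t g x ∂gaussianPi ι = ∫ x, f x * ouOp (s + t) g x ∂gaussianPi ι := by
  rw [← integral_ouOp_symm hf (hg.ouOp t) hs]
  simp only [ouOp_ouOp hg hs ht]

lemma integral_mul_ouOp_self_nonneg (hf : BddMeas f) (ht : 0 ≤ t) :
    0 ≤ ∫ x, f x * ouOp t f x ∂gaussianPi ι := by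
  have h := integral_mul_ouOp_ouOp hf hf (show 0 ≤ t / 2 by linarith) (show 0 ≤ t / 2 by linarith)
  rw [add_halves] at h
  rw [← h]
  exact integral_nonneg fun x => mul_self_nonneg _

end OU

lemma integral_sub_two_mul_add {α : Type*} [MeasurableSpace α] {μ : Measure α} {a b c : α → ℝ}
    (ha : Integrable a μ) (hb : Integrable b μ) (hc : Integrable c μ) :
    ∫ x, (a x - 2 * b x) + c x ∂μ = ∫ x, a x ∂μ - 2 * ∫ x, b x ∂μ + ∫ x, c x ∂μ := by
  rw [integral_add (f := fun x => a x - 2 * b x) (ha.sub (hb.const_mul 2)) hc,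
    integral_sub ha (hb.const_mul 2), integral_const_mul]

section Stability

variable {ι : Type*} [Fintype ι] {f g : (ι → ℝ) → ℝ} {s t : ℝ}

lemma integral_sub_mix_sq (hf : BddMeas f) (hs : 0 ≤ s) :
    ∫ p, (f p.1 - f (mix s p.1 p.2)) ^ 2 ∂(gaussianPi ι).prod (gaussianPi ι) =
      2 * (∫ x, f x * f x ∂gaussianPi ι - ∫ x, f x * ouOp s f x ∂gaussianPi ι) := by
  have h1 : BddMeas fun p : (ι → ℝ) × (ι → ℝ) => f p.1 := hf.comp measurable_fst
  have h2 : BddMeas fun p : (ι → ℝ) × (ι → ℝ) => f (mix s p.1 p.2) := hf.comp (measurable_mix s)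
  have hm := (hf.mul hf).measurable.aestronglyMeasurable (μ := gaussianPi ι)
  have e1 : ∫ p, f p.1 * f p.1 ∂(gaussianPi ι).prod (gaussianPi ι) =
      ∫ x, f x * f x ∂gaussianPi ι := by
    have h := measurePreserving_fst (μ := gaussianPi ι) (ν := gaussianPi ι)
    conv_rhs => rw [← h.map_eq]
    rw [integral_map h.measurable.aemeasurable (by rwa [h.map_eq])]
  have e2 : ∫ p, f (mix s p.1 p.2) * f (mix s p.1 p.2) ∂(gaussianPi ι).prod (gaussianPi ι) =
      ∫ x, f x * f x ∂gaussianPi ι := by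
    have h := measurePreserving_mix_exp (ι := ι) hs
    conv_rhs => rw [← h.map_eq]
    rw [integral_map h.measurable.aemeasurable (by rwa [h.map_eq])]
  have e3 := integral_mul_ouOp hf hf s
  have h11 := (h1.mul h1).integrable ((gaussianPi ι).prod (gaussianPi ι))
  have h22 := (h2.mul h2).integrable ((gaussianPi ι).prod (gaussianPi ι))
  have h12 := (h1.mul h2).integrable ((gaussianPi ι).prod (gaussianPi ι))
  calc _ = ∫ p, (f p.1 * f p.1 - 2 * (f p.1 * f (mix s p.1 p.2))) +
        f (mix s p.1 p.2) * f (mix s p.1 p.2) ∂(gaussianPi ι).prod (gaussianPi ι) := by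
        congr 1; ext p; ring
    _ = _ := by
        rw [integral_sub_two_mul_add h11 h12 h22, e1, e2, e3]
        ring

lemma integral_mul_ouOp_le_one (hf : Measurable f) (hf1 : ∀ x, |f x| ≤ 1) (t : ℝ) :
    ∫ x, f x * ouOp t f x ∂gaussianPi ι ≤ 1 := by
  have hb : BddMeas f := ⟨hf, 1, hf1⟩
  rw [integral_mul_ouOp hb hb]
  have h : BddMeas fun p : (ι → ℝ) × (ι → ℝ) => f p.1 * f (mix t p.1 p.2) :=
    (hb.comp measurable_fst).mul (hb.comp (measurable_mix t))
  calc _ ≤ ∫ p, (1 : ℝ) ∂(gaussianPi ι).prod (gaussianPi ι) := by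
        refine integral_mono (h.integrable _) (integrable_const _) fun p => ?_
        refine (le_abs_self _).trans ?_
        rw [abs_mul]
        exact mul_le_one₀ (hf1 _) (abs_nonneg _) (hf1 _)
    _ = 1 := by simp

/-- Second differences of `t ↦ E[f P_t f]` are nonnegative. -/
lemma integral_mul_ouOp_second_diff (hf : BddMeas f) (hs : 0 ≤ s) (ht : 0 ≤ t) :
    ∫ x, f x * ouOp (t + s) f x ∂gaussianPi ι - ∫ x, f x * ouOp (t + 2 * s) f x ∂gaussianPi ι ≤
      ∫ x, f x * ouOp t f x ∂gaussianPi ι - ∫ x, f x * ouOp (t + s) f x ∂gaussianPi ι := by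
  have ht2 : 0 ≤ t / 2 := by linarith
  have hts : 0 ≤ t / 2 + s := by linarith
  have e1 := integral_mul_ouOp_ouOp hf hf ht2 ht2
  have e2 := integral_mul_ouOp_ouOp hf hf ht2 hts
  have e3 := integral_mul_ouOp_ouOp hf hf hts hts
  rw [show t / 2 + t / 2 = t by ring] at e1
  rw [show t / 2 + (t / 2 + s) = t + s by ring] at e2
  rw [show t / 2 + s + (t / 2 + s) = t + 2 * s by ring] at e3
  have hu := hf.ouOp (t / 2)
  have hv := hf.ouOp (t / 2 + s)
  have h11 := (hu.mul hu).integrable (gaussianPi ι)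
  have h12 := (hu.mul hv).integrable (gaussianPi ι)
  have h22 := (hv.mul hv).integrable (gaussianPi ι)
  have key : 0 ≤ ∫ x, (ouOp (t / 2) f x * ouOp (t / 2) f x -
      2 * (ouOp (t / 2) f x * ouOp (t / 2 + s) f x)) +
      ouOp (t / 2 + s) f x * ouOp (t / 2 + s) f x ∂gaussianPi ι := by
    refine integral_nonneg fun x => ?_
    have := sq_nonneg (ouOp (t / 2) f x - ouOp (t / 2 + s) f x)
    simp only [Pi.zero_apply]
    linarith
  rw [integral_sub_two_mul_add h11 h12 h22] at key
  linarith

lemma nsmul_diff_le (hf : Measurable f) (hf1 : ∀ x, |f x| ≤ 1) (hs : 0 ≤ s) (ht : 0 ≤ t) (N : ℕ) :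
    N * (∫ x, f x * ouOp (t + N * s) f x ∂gaussianPi ι -
      ∫ x, f x * ouOp (t + (N + 1) * s) f x ∂gaussianPi ι) ≤ 1 := by
  have hb : BddMeas f := ⟨hf, 1, hf1⟩
  set b : ℕ → ℝ := fun j => ∫ x, f x * ouOp (t + j * s) f x ∂gaussianPi ι with hbdef
  have hanti : Antitone fun j => b j - b (j + 1) := by
    refine antitone_nat_of_succ_le fun j => ?_
    have := integral_mul_ouOp_second_diff hb hs (t := t + j * s) (by positivity)
    simp only [hbdef]
    push_cast
    rw [show t + (j + 1) * s = t + j * s + s by ring,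
      show t + ((j : ℝ) + 1 + 1) * s = t + j * s + 2 * s by ring]
    exact this
  have hsum : ∑ j ∈ Finset.range N, (b j - b (j + 1)) = b 0 - b N := Finset.sum_range_sub' b N
  have hle : N • (b N - b (N + 1)) ≤ ∑ j ∈ Finset.range N, (b j - b (j + 1)) := by
    have := Finset.card_nsmul_le_sum (Finset.range N) (fun j => b j - b (j + 1))
      (b N - b (N + 1)) fun j hj => hanti (Finset.mem_range.1 hj).le
    rwa [Finset.card_range] at this
  have h0 : b 0 ≤ 1 := integral_mul_ouOp_le_one hf hf1 _
  have hN : 0 ≤ b N := integral_mul_ouOp_self_nonneg hb (by positivity)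
  have : (N : ℝ) * (b N - b (N + 1)) ≤ 1 := by
    rw [nsmul_eq_mul] at hle
    linarith
  simpa [hbdef] using this

/-- Noise sensitivity of `P_t f` at scale `s`, for `t` large compared to `s`. -/
lemma integral_ouOp_sub_mix_sq_le (hf : Measurable f) (hf1 : ∀ x, |f x| ≤ 1) (hs : 0 ≤ s)
    (N : ℕ) (hN : 0 < N) (hst : N * s ≤ 2 * t) :
    ∫ p, (ouOp t f p.1 - ouOp t f (mix s p.1 p.2)) ^ 2 ∂(gaussianPi ι).prod (gaussianPi ι) ≤
      2 / N := by
  have hb : BddMeas f := ⟨hf, 1, hf1⟩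
  have ht : 0 ≤ t := by
    have : 0 ≤ N * s := by positivity
    linarith
  have e1 := integral_mul_ouOp_ouOp hb hb ht ht
  have e2 : ∫ x, ouOp t f x * ouOp s (ouOp t f) x ∂gaussianPi ι =
      ∫ x, f x * ouOp (t + t + s) f x ∂gaussianPi ι := by
    simp only [ouOp_ouOp hb hs ht]
    rw [integral_mul_ouOp_ouOp hb hb ht (add_nonneg hs ht)]
    congr! 4
    ring
  rw [integral_sub_mix_sq (hb.ouOp t) hs, e1, e2]
  have h := nsmul_diff_le hf hf1 hs (t := 2 * t - N * s) (by linarith) N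
  rw [show 2 * t - N * s + N * s = t + t by ring,
    show 2 * t - N * s + (N + 1) * s = t + t + s by ring] at h
  have hN' : (0 : ℝ) < N := by exact_mod_cast hN
  rw [le_div_iff₀ hN']
  linarith

/-- If `h` correlates with `P_t f` almost as well as `f` does, then `h` is almost as noise
stable as `f`. -/
lemma two_mul_integral_ouOp_le (hf : BddMeas f) (hg : BddMeas g) (ht : 0 ≤ t) :
    2 * ∫ x, g x * ouOp t f x ∂gaussianPi ι - ∫ x, f x * ouOp t f x ∂gaussianPi ι ≤
      ∫ x, g x * ouOp t g x ∂gaussianPi ι := by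
  have h := integral_mul_ouOp_self_nonneg (hg.sub hf) ht
  have hsymm := integral_ouOp_symm hf hg ht
  have i1 := (hg.mul (hg.ouOp t)).integrable (gaussianPi ι)
  have i2 := (hg.mul (hf.ouOp t)).integrable (gaussianPi ι)
  have i3 := ((hf.ouOp t).mul hg).integrable (gaussianPi ι)
  have i4 := (hf.mul (hf.ouOp t)).integrable (gaussianPi ι)
  have i5 := (hf.mul (hg.ouOp t)).integrable (gaussianPi ι)
  have e : ∀ x, (g x - f x) * ouOp t (fun y => g y - f y) x =
      (g x * ouOp t g x - g x * ouOp t f x) - (f x * ouOp t g x - f x * ouOp t f x) := fun x => by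
    rw [ouOp_sub hg hf]; ring
  simp only [e] at h
  rw [integral_sub (f := fun x => g x * ouOp t g x - g x * ouOp t f x)
    (g := fun x => f x * ouOp t g x - f x * ouOp t f x) (i1.sub i2) (i5.sub i4),
    integral_sub i1 i2, integral_sub i5 i4, hsymm] at h
  simp only [mul_comm (ouOp t f _)] at h
  linarith

end Stability

section HermiteOneDim

lemma integrable_polynomial_gaussianReal (p : Polynomial ℝ) :
    Integrable (fun x => p.eval x) (gaussianReal 0 1) := by
  simp only [Polynomial.eval_eq_sum_range]
  refine integrable_finsetSum _ fun i _ => Integrable.const_mul ?_ _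
  have h := integrable_pow_of_mem_interior_integrableExpSet (X := fun x : ℝ => x)
    (μ := gaussianReal 0 1) (by simp [integrableExpSet_fun_id_gaussianReal]) i
  exact h

lemma integrable_polynomial_mul_gaussianPDFReal (p : Polynomial ℝ) :
    Integrable (fun x => p.eval x * gaussianPDFReal 0 1 x) := by
  have h := integrable_polynomial_gaussianReal p
  rw [gaussianReal_of_var_ne_zero _ one_ne_zero,
    integrable_withDensity_iff_integrable_smul' (measurable_gaussianPDF 0 1)
      (Filter.Eventually.of_forall fun _ => gaussianPDF_lt_top)] at h
  simpa only [toReal_gaussianPDF, smul_eq_mul, mul_comm] using h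

lemma hasDerivAt_gaussianPDFReal (x : ℝ) :
    HasDerivAt (gaussianPDFReal 0 1) (-x * gaussianPDFReal 0 1 x) x := by
  simp only [gaussianPDFReal_def, sub_zero]
  have h : HasDerivAt (fun y : ℝ => -y ^ 2 / (2 * ((1 : NNReal) : ℝ))) (-x) x := by
    refine (((hasDerivAt_pow 2 x).fun_neg).div_const _).congr_deriv ?_
    simp
    ring
  refine (h.exp.const_mul (Real.sqrt (2 * Real.pi * ((1 : NNReal) : ℝ)))⁻¹).congr_deriv ?_
  ring

/-- Gaussian integration by parts for polynomials. -/
lemma integral_mul_polynomial_gaussianReal (p : Polynomial ℝ) :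
    ∫ x, x * p.eval x ∂gaussianReal 0 1 =
      ∫ x, (Polynomial.derivative p).eval x ∂gaussianReal 0 1 := by
  have h1 := integrable_polynomial_mul_gaussianPDFReal (Polynomial.X * p)
  simp only [Polynomial.eval_mul, Polynomial.eval_X] at h1
  have h := integral_mul_deriv_eq_deriv_mul_of_integrable
    (u := fun x => p.eval x) (v := gaussianPDFReal 0 1)
    (u' := fun x => (Polynomial.derivative p).eval x)
    (v' := fun x => -x * gaussianPDFReal 0 1 x)
    (fun x _ => p.hasDerivAt x) (fun x _ => hasDerivAt_gaussianPDFReal x)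
    (by
      convert h1.neg using 1
      ext x
      simp only [Pi.mul_apply, Pi.neg_apply]
      ring)
    (integrable_polynomial_mul_gaussianPDFReal _) (integrable_polynomial_mul_gaussianPDFReal _)
  rw [integral_gaussianReal_eq_integral_smul one_ne_zero,
    integral_gaussianReal_eq_integral_smul one_ne_zero]
  simp only [smul_eq_mul]
  have e1 : ∫ x, p.eval x * (-x * gaussianPDFReal 0 1 x) =
      -∫ x, gaussianPDFReal 0 1 x * (x * p.eval x) := by
    rw [← integral_neg]
    congr 1; ext x; ring
  rw [e1] at h
  rw [neg_injective h]
  congr 1; ext x; ring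

/-- The probabilists' Hermite polynomial with real coefficients. -/
def hermiteR (n : ℕ) : Polynomial ℝ := (Polynomial.hermite n).map (Int.castRingHom ℝ)

lemma aeval_hermite (n : ℕ) (x : ℝ) :
    Polynomial.aeval x (Polynomial.hermite n) = (hermiteR n).eval x := by
  rw [Polynomial.aeval_def, hermiteR, Polynomial.eval₂_eq_eval_map]
  rfl

lemma hermiteR_zero : hermiteR 0 = 1 := by simp [hermiteR]

lemma hermiteR_succ (n : ℕ) :
    hermiteR (n + 1) = Polynomial.X * hermiteR n - Polynomial.derivative (hermiteR n) := by
  simp [hermiteR, Polynomial.hermite_succ, Polynomial.derivative_map]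

lemma derivative_hermiteR_succ (n : ℕ) :
    Polynomial.derivative (hermiteR (n + 1)) = ((n : Polynomial ℝ) + 1) * hermiteR n := by
  induction n with
  | zero => simp [hermiteR_succ, hermiteR_zero]
  | succ n ih =>
    rw [hermiteR_succ (n + 1)]
    simp only [Polynomial.derivative_sub, Polynomial.derivative_mul, Polynomial.derivative_X, ih,
      Polynomial.derivative_add, Polynomial.derivative_natCast, Polynomial.derivative_one]
    rw [hermiteR_succ n]
    push_cast
    ring

lemma eval_hermiteR_succ_succ (n : ℕ) (x : ℝ) :
    (hermiteR (n + 2)).eval x =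
      x * (hermiteR (n + 1)).eval x - (n + 1) * (hermiteR n).eval x := by
  rw [hermiteR_succ (n + 1), derivative_hermiteR_succ]
  simp

lemma integral_hermiteR_succ_mul (n : ℕ) (q : Polynomial ℝ) :
    ∫ x, (hermiteR (n + 1)).eval x * q.eval x ∂gaussianReal 0 1 =
      ∫ x, (hermiteR n).eval x * (Polynomial.derivative q).eval x ∂gaussianReal 0 1 := by
  have h := integral_mul_polynomial_gaussianReal (hermiteR n * q)
  have i1 := integrable_polynomial_gaussianReal (Polynomial.X * (hermiteR n * q))
  have i2 := integrable_polynomial_gaussianReal (Polynomial.derivative (hermiteR n) * q)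
  have i3 := integrable_polynomial_gaussianReal (hermiteR n * Polynomial.derivative q)
  simp only [Polynomial.derivative_mul, Polynomial.eval_mul, Polynomial.eval_add,
    Polynomial.eval_X] at h i1 i2 i3
  rw [integral_add i2 i3] at h
  calc _ = ∫ x, (x * ((hermiteR n).eval x * q.eval x) -
        (Polynomial.derivative (hermiteR n)).eval x * q.eval x) ∂gaussianReal 0 1 := by
        congr 1; ext x; simp [hermiteR_succ]; ring
    _ = _ := by rw [integral_sub i1 i2, h]; ring

lemma integral_hermiteR_mul_hermiteR (m n : ℕ) :
    ∫ x, (hermiteR m).eval x * (hermiteR n).eval x ∂gaussianReal 0 1 =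
      if m = n then (n.factorial : ℝ) else 0 := by
  induction m generalizing n with
  | zero =>
    cases n with
    | zero => simp [hermiteR_zero]
    | succ n =>
      have h := integral_hermiteR_succ_mul n 1
      simp only [Polynomial.eval_one, mul_one, Polynomial.derivative_one, Polynomial.eval_zero,
        mul_zero, integral_zero] at h
      simpa [hermiteR_zero] using h
  | succ m ih =>
    rw [integral_hermiteR_succ_mul]
    cases n with
    | zero => simp [hermiteR_zero]
    | succ n =>
      rw [derivative_hermiteR_succ]
      have e : ∀ x : ℝ, (hermiteR m).eval x * (((n : Polynomial ℝ) + 1) * hermiteR n).eval x =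
          ((n : ℝ) + 1) * ((hermiteR m).eval x * (hermiteR n).eval x) := fun x => by
        simp; ring
      simp only [e, integral_const_mul, ih]
      by_cases hmn : m = n
      · simp [hmn, Nat.factorial_succ]
      · simp [hmn]

lemma integral_hermiteR_mix {a b : ℝ} (hab : a ^ 2 + b ^ 2 = 1) (n : ℕ) (x : ℝ) :
    ∫ y, (hermiteR n).eval (a * x + b * y) ∂gaussianReal 0 1 = a ^ n * (hermiteR n).eval x := by
  have hcomp : ∀ (p : Polynomial ℝ) (y : ℝ),
      p.eval (a * x + b * y) =
        (p.comp (Polynomial.C (a * x) + Polynomial.C b * Polynomial.X)).eval y := by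
    intro p y; simp
  have hint : ∀ p : Polynomial ℝ, Integrable (fun y => p.eval (a * x + b * y))
      (gaussianReal 0 1) := fun p => by
    simp only [hcomp]; exact integrable_polynomial_gaussianReal _
  have hstein : ∀ p : Polynomial ℝ, ∫ y, y * p.eval (a * x + b * y) ∂gaussianReal 0 1 =
      b * ∫ y, (Polynomial.derivative p).eval (a * x + b * y) ∂gaussianReal 0 1 := fun p => by
    simp only [hcomp p]
    rw [integral_mul_polynomial_gaussianReal, ← integral_const_mul]
    congr 1; ext y
    simp [Polynomial.derivative_comp]
  have hint' : ∀ p : Polynomial ℝ, Integrable (fun y => y * p.eval (a * x + b * y))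
      (gaussianReal 0 1) := fun p => by
    have := integrable_polynomial_gaussianReal
      (Polynomial.X * p.comp (Polynomial.C (a * x) + Polynomial.C b * Polynomial.X))
    simpa using this
  induction n using Nat.twoStepInduction with
  | zero => simp [hermiteR_zero]
  | one =>
    have h := hstein 1
    simp only [Polynomial.eval_one, mul_one, Polynomial.derivative_one, Polynomial.eval_zero,
      integral_zero, mul_zero] at h
    have hi := hint' 1
    simp only [Polynomial.eval_one, mul_one] at hi
    simp only [hermiteR_succ, hermiteR_zero, Polynomial.derivative_one, mul_one, sub_zero,
      Polynomial.eval_X, pow_one]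
    rw [integral_add (f := fun _ => a * x) (integrable_const _) (hi.const_mul b),
      integral_const_mul b, h]
    simp
  | more n ih1 ih2 =>
    have e : ∀ y : ℝ, (hermiteR (n + 2)).eval (a * x + b * y) =
        (a * x) * (hermiteR (n + 1)).eval (a * x + b * y) +
          (b * (y * (hermiteR (n + 1)).eval (a * x + b * y)) -
          ((n : ℝ) + 1) * (hermiteR n).eval (a * x + b * y)) := fun y => by
      rw [eval_hermiteR_succ_succ]; ring
    simp only [e]
    rw [integral_add (g := fun y => b * (y * (hermiteR (n + 1)).eval (a * x + b * y)) -
        ((n : ℝ) + 1) * (hermiteR n).eval (a * x + b * y)) ((hint _).const_mul _)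
        (((hint' _).const_mul b).sub ((hint _).const_mul _)),
      integral_sub ((hint' _).const_mul b) ((hint _).const_mul _)]
    simp only [integral_const_mul, hstein, derivative_hermiteR_succ]
    have e2 : ∀ y : ℝ, (((n : Polynomial ℝ) + 1) * hermiteR n).eval (a * x + b * y) =
        ((n : ℝ) + 1) * (hermiteR n).eval (a * x + b * y) := fun y => by simp
    simp only [e2, integral_const_mul, ih1, ih2, eval_hermiteR_succ_succ]
    linear_combination (-(n + 1) * a ^ n * (hermiteR n).eval x) * (-hab)

end HermiteOneDim

section Bessel

/-- A Bessel-type inequality for an orthogonal family that need not be normalized. -/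
lemma sum_mul_sq_le_integral_sq {α Ω : Type*} [MeasurableSpace Ω] {ν : Measure Ω} (T : Finset α)
    {w : α → Ω → ℝ} {D : Ω → ℝ} {a c : α → ℝ} (hw : ∀ S, MemLp (w S) 2 ν) (hD : MemLp D 2 ν)
    (hww : ∀ S S', ∫ p, w S p * w S' p ∂ν = if S = S' then a S else 0)
    (hwD : ∀ S, ∫ p, w S p * D p ∂ν = a S * c S) :
    ∑ S ∈ T, a S * c S ^ 2 ≤ ∫ p, D p * D p ∂ν := by
  have h0 : 0 ≤ ∫ p, (D p - ∑ S ∈ T, c S * w S p) * (D p - ∑ S ∈ T, c S * w S p) ∂ν :=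
    integral_nonneg fun p => mul_self_nonneg _
  have e : ∀ p, (D p - ∑ S ∈ T, c S * w S p) * (D p - ∑ S ∈ T, c S * w S p) =
      (D p * D p - 2 * ∑ S ∈ T, c S * (w S p * D p)) +
        ∑ S ∈ T, ∑ S' ∈ T, (c S * c S') * (w S p * w S' p) := fun p => by
    have e1 : ∑ S ∈ T, c S * (w S p * D p) = (∑ S ∈ T, c S * w S p) * D p := by
      rw [Finset.sum_mul]; exact Finset.sum_congr rfl fun _ _ => by ring
    have e2 : ∑ S ∈ T, ∑ S' ∈ T, (c S * c S') * (w S p * w S' p) =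
        (∑ S ∈ T, c S * w S p) * ∑ S ∈ T, c S * w S p := by
      rw [Finset.sum_mul_sum]
      exact Finset.sum_congr rfl fun _ _ => Finset.sum_congr rfl fun _ _ => by ring
    rw [e1, e2]; ring
  have i1 : Integrable (fun p => D p * D p) ν := hD.integrable_mul hD
  have i2 : ∀ S ∈ T, Integrable (fun p => c S * (w S p * D p)) ν := fun S _ =>
    ((hw S).integrable_mul hD).const_mul _
  have i3 : ∀ S ∈ T, ∀ S' ∈ T, Integrable (fun p => (c S * c S') * (w S p * w S' p)) ν :=
    fun S _ S' _ => ((hw S).integrable_mul (hw S')).const_mul _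
  simp only [e] at h0
  rw [integral_sub_two_mul_add i1 (integrable_finsetSum _ i2)
    (integrable_finsetSum _ fun S hS => integrable_finsetSum _ (i3 S hS)),
    integral_finsetSum _ i2,
    integral_finsetSum _ fun S hS => integrable_finsetSum _ (i3 S hS)] at h0
  have e3 : ∑ S ∈ T, ∫ p, ∑ S' ∈ T, (c S * c S') * (w S p * w S' p) ∂ν =
      ∑ S ∈ T, a S * c S ^ 2 := by
    refine Finset.sum_congr rfl fun S hS => ?_
    rw [integral_finsetSum _ (i3 S hS)]
    simp only [integral_const_mul, hww, mul_ite, mul_zero, Finset.sum_ite_eq, hS, if_true]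
    ring
  have e4 : ∑ S ∈ T, ∫ p, c S * (w S p * D p) ∂ν = ∑ S ∈ T, a S * c S ^ 2 := by
    refine Finset.sum_congr rfl fun S hS => ?_
    rw [integral_const_mul, hwD]
    ring
  rw [e3, e4] at h0
  linarith

variable {ι : Type*} [Fintype ι] {t : ℝ}

lemma integral_sub_mix_mul_sub_mix (ht : 0 ≤ t) {f g : (ι → ℝ) → ℝ} (hfm : Measurable f)
    (hgm : Measurable g) (hf : MemLp f 2 (gaussianPi ι)) (hg : MemLp g 2 (gaussianPi ι)) :
    ∫ p, (f p.1 - f (mix t p.1 p.2)) * (g p.1 - g (mix t p.1 p.2))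
        ∂(gaussianPi ι).prod (gaussianPi ι) =
      2 * (∫ x, g x * f x ∂gaussianPi ι - ∫ x, g x * ouOp t f x ∂gaussianPi ι) := by
  have hX : MeasurePreserving (fun p : (ι → ℝ) × (ι → ℝ) => p.1)
    ((gaussianPi ι).prod (gaussianPi ι)) (gaussianPi ι) := measurePreserving_fst
  have hY := measurePreserving_mix_exp (ι := ι) ht
  have f1 := hf.comp_measurePreserving hX
  have f2 := hf.comp_measurePreserving hY
  have g1 := hg.comp_measurePreserving hX
  have g2 := hg.comp_measurePreserving hY
  have i11 : Integrable (fun p : (ι → ℝ) × (ι → ℝ) => g p.1 * f p.1)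
    ((gaussianPi ι).prod (gaussianPi ι)) := g1.integrable_mul f1
  have i12 : Integrable (fun p : (ι → ℝ) × (ι → ℝ) => g p.1 * f (mix t p.1 p.2))
    ((gaussianPi ι).prod (gaussianPi ι)) := g1.integrable_mul f2
  have i21 : Integrable (fun p : (ι → ℝ) × (ι → ℝ) => f p.1 * g (mix t p.1 p.2))
    ((gaussianPi ι).prod (gaussianPi ι)) := f1.integrable_mul g2
  have i22 : Integrable (fun p : (ι → ℝ) × (ι → ℝ) => g (mix t p.1 p.2) * f (mix t p.1 p.2))
    ((gaussianPi ι).prod (gaussianPi ι)) := g2.integrable_mul f2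
  have hgf := (hgm.mul hfm).aestronglyMeasurable (μ := gaussianPi ι)
  have e11 : ∫ p, g p.1 * f p.1 ∂(gaussianPi ι).prod (gaussianPi ι) =
      ∫ x, g x * f x ∂gaussianPi ι := by
    conv_rhs => rw [← hX.map_eq]
    rw [integral_map hX.measurable.aemeasurable (by rw [hX.map_eq]; exact hgf)]
  have e22 : ∫ p, g (mix t p.1 p.2) * f (mix t p.1 p.2) ∂(gaussianPi ι).prod (gaussianPi ι) =
      ∫ x, g x * f x ∂gaussianPi ι := by
    conv_rhs => rw [← hY.map_eq]
    rw [integral_map hY.measurable.aemeasurable (by rw [hY.map_eq]; exact hgf)]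
  have e12 : ∫ p, g p.1 * f (mix t p.1 p.2) ∂(gaussianPi ι).prod (gaussianPi ι) =
      ∫ x, g x * ouOp t f x ∂gaussianPi ι := by
    rw [integral_prod _ i12]
    simp only [ouOp_eq, integral_const_mul]
  have e21 : ∫ p, f p.1 * g (mix t p.1 p.2) ∂(gaussianPi ι).prod (gaussianPi ι) =
      ∫ x, g x * ouOp t f x ∂gaussianPi ι := by
    rw [← e12, integral_pair_symm ht (F := fun x y => f x * g y)
      ((hfm.comp measurable_fst).mul (hgm.comp measurable_snd))]
    simp only [mul_comm]
  have e : ∀ p : (ι → ℝ) × (ι → ℝ), (f p.1 - f (mix t p.1 p.2)) * (g p.1 - g (mix t p.1 p.2)) =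
      (g p.1 * f p.1 + g (mix t p.1 p.2) * f (mix t p.1 p.2)) -
        (g p.1 * f (mix t p.1 p.2) + f p.1 * g (mix t p.1 p.2)) := fun p => by ring
  simp only [e]
  rw [integral_sub (f := fun p : (ι → ℝ) × (ι → ℝ) =>
      g p.1 * f p.1 + g (mix t p.1 p.2) * f (mix t p.1 p.2)) (g := fun p =>
      g p.1 * f (mix t p.1 p.2) + f p.1 * g (mix t p.1 p.2)) (i11.add i22) (i12.add i21),
    integral_add i11 i22, integral_add i12 i21, e11, e12, e21, e22]
  ring

lemma measurable_hermiteH (S : ι → ℕ) : Measurable (hermiteH S) := by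
  unfold hermiteH
  simp only [aeval_hermite]
  fun_prop

lemma integrable_hermiteH_mul (S T : ι → ℕ) :
    Integrable (fun x => hermiteH S x * hermiteH T x) (gaussianPi ι) := by
  simp only [hermiteH, ← Finset.prod_mul_distrib, aeval_hermite]
  refine Integrable.fintype_prod (f := fun i y => (hermiteR (S i)).eval y / _ *
    ((hermiteR (T i)).eval y / _)) fun i => ?_
  have h := (integrable_polynomial_gaussianReal (hermiteR (S i) * hermiteR (T i))).const_mul
    ((Real.sqrt (Nat.factorial (S i)))⁻¹ * (Real.sqrt (Nat.factorial (T i)))⁻¹)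
  convert h using 1
  ext y
  simp only [Polynomial.eval_mul]
  ring

lemma memLp_hermiteH (S : ι → ℕ) : MemLp (hermiteH S) 2 (gaussianPi ι) := by
  rw [memLp_two_iff_integrable_sq (measurable_hermiteH S).aestronglyMeasurable]
  simpa only [sq] using integrable_hermiteH_mul S S

lemma integral_hermiteH_mul (S T : ι → ℕ) :
    ∫ x, hermiteH S x * hermiteH T x ∂gaussianPi ι = if S = T then 1 else 0 := by
  simp only [hermiteH, ← Finset.prod_mul_distrib, aeval_hermite]
  rw [gaussianPi, integral_fintype_prod_eq_prod (f := fun i y => (hermiteR (S i)).eval y / _ *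
    ((hermiteR (T i)).eval y / _))]
  have h : ∀ i, ∫ y, (hermiteR (S i)).eval y / Real.sqrt (Nat.factorial (S i)) *
      ((hermiteR (T i)).eval y / Real.sqrt (Nat.factorial (T i))) ∂gaussianReal 0 1 =
      if S i = T i then 1 else 0 := fun i => by
    have e : ∀ y, (hermiteR (S i)).eval y / Real.sqrt (Nat.factorial (S i)) *
        ((hermiteR (T i)).eval y / Real.sqrt (Nat.factorial (T i))) =
        ((Real.sqrt (Nat.factorial (S i)))⁻¹ * (Real.sqrt (Nat.factorial (T i)))⁻¹) *
          ((hermiteR (S i)).eval y * (hermiteR (T i)).eval y) := fun y => by ring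
    simp only [e, integral_const_mul, integral_hermiteR_mul_hermiteR]
    split_ifs with hi
    · have hp : (0 : ℝ) < (T i).factorial := by exact_mod_cast Nat.factorial_pos _
      rw [hi, ← mul_inv, Real.mul_self_sqrt hp.le, inv_mul_cancel₀ hp.ne']
    · simp
  simp only [h]
  rw [Finset.prod_ite_zero]
  simp [funext_iff]

lemma ouOp_hermiteH (ht : 0 ≤ t) (S : ι → ℕ) (x : ι → ℝ) :
    ouOp t (hermiteH S) x = Real.exp (-t) ^ (∑ i, S i) * hermiteH S x := by
  simp only [ouOp, hermiteH, aeval_hermite]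
  rw [gaussianPi, integral_fintype_prod_eq_prod (f := fun i y => (hermiteR (S i)).eval
    (Real.exp (-t) * x i + Real.sqrt (1 - Real.exp (-2 * t)) * y) / _)]
  simp only [integral_div, integral_hermiteR_mix (exp_sq_add_sqrt_sq ht),
    ← Finset.prod_pow_eq_pow_sum, ← Finset.prod_mul_distrib, mul_div_assoc]

lemma sum_one_sub_exp_mul_hermCoeff_sq_le (ht : 0 ≤ t) {f : (ι → ℝ) → ℝ} (hf : BddMeas f)
    (T : Finset (ι → ℕ)) :
    ∑ S ∈ T, (1 - Real.exp (-t) ^ (∑ i, S i)) * hermCoeff f S ^ 2 ≤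
      ∫ x, f x * f x ∂gaussianPi ι - ∫ x, f x * ouOp t f x ∂gaussianPi ι := by
  have hX : MeasurePreserving (fun p : (ι → ℝ) × (ι → ℝ) => p.1)
    ((gaussianPi ι).prod (gaussianPi ι)) (gaussianPi ι) := measurePreserving_fst
  have hY := measurePreserving_mix_exp (ι := ι) ht
  have hL : ∀ {g : (ι → ℝ) → ℝ}, MemLp g 2 (gaussianPi ι) →
      MemLp (fun p : (ι → ℝ) × (ι → ℝ) => g p.1 - g (mix t p.1 p.2)) 2
        ((gaussianPi ι).prod (gaussianPi ι)) := fun hg =>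
    (hg.comp_measurePreserving hX).sub (hg.comp_measurePreserving hY)
  have hfL := hf.memLp (gaussianPi ι)
  have h := sum_mul_sq_le_integral_sq T
    (w := fun S (p : (ι → ℝ) × (ι → ℝ)) => hermiteH S p.1 - hermiteH S (mix t p.1 p.2))
    (D := fun p : (ι → ℝ) × (ι → ℝ) => f p.1 - f (mix t p.1 p.2))
    (a := fun S => 2 * (1 - Real.exp (-t) ^ (∑ i, S i))) (c := hermCoeff f)
    (fun S => hL (memLp_hermiteH S)) (hL hfL) (fun S S' => by
      rw [integral_sub_mix_mul_sub_mix ht (measurable_hermiteH S) (measurable_hermiteH S')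
        (memLp_hermiteH S) (memLp_hermiteH S')]
      simp only [ouOp_hermiteH ht, mul_left_comm (hermiteH S' _), integral_const_mul,
        integral_hermiteH_mul, eq_comm (a := S')]
      split_ifs <;> ring) (fun S => by
      rw [integral_sub_mix_mul_sub_mix ht (measurable_hermiteH S) hf.measurable
        (memLp_hermiteH S) hfL]
      simp only [ouOp_hermiteH ht, mul_left_comm (f _), integral_const_mul, hermCoeff]
      ring)
  rw [integral_sub_mix_mul_sub_mix ht hf.measurable hf.measurable hfL hfL] at h
  simp only [mul_assoc, ← Finset.mul_sum] at h
  linarith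

end Bessel

section NoiseStability

variable {ι : Type*} [Fintype ι] {k : ℕ} {h : (ι → ℝ) → Fin k} {s : ℝ}

lemma abs_basisVec_le_one (i j : Fin k) : |basisVec i j| ≤ 1 := by
  unfold basisVec; split_ifs <;> norm_num

lemma sum_basisVec_mul (i : Fin k) (F : Fin k → ℝ) : ∑ j, basisVec i j * F j = F i := by
  simp [basisVec]

lemma measurable_basisVec_comp {α : Type*} [MeasurableSpace α] {h : α → Fin k} (hh : Measurable h)
    (j : Fin k) : Measurable fun x => basisVec (h x) j :=
  (measurable_of_finite fun i : Fin k => basisVec i j).comp hh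

lemma bddMeas_basisVec_comp {α : Type*} [MeasurableSpace α] {h : α → Fin k} (hh : Measurable h)
    (j : Fin k) : BddMeas fun x => basisVec (h x) j :=
  ⟨measurable_basisVec_comp hh j, 1, fun _ => abs_basisVec_le_one _ _⟩

lemma noiseStab_eq_sum (hh : Measurable h) (s : ℝ) :
    noiseStab s h = ∑ j, ∫ x, basisVec (h x) j * ouOp s (fun y => basisVec (h y) j) x
      ∂gaussianPi ι :=
  integral_finsetSum _ fun j _ =>
    ((bddMeas_basisVec_comp hh j).mul ((bddMeas_basisVec_comp hh j).ouOp s)).integrable _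

lemma noiseStab_eq_measureReal (hh : Measurable h) (s : ℝ) :
    noiseStab s h =
      ((gaussianPi ι).prod (gaussianPi ι)).real {p | h p.1 = h (mix s p.1 p.2)} := by
  have hm : MeasurableSet {p : (ι → ℝ) × (ι → ℝ) | h p.1 = h (mix s p.1 p.2)} :=
    measurableSet_eq_fun (hh.comp measurable_fst) (hh.comp (measurable_mix s))
  rw [noiseStab_eq_sum hh]
  simp only [integral_mul_ouOp (bddMeas_basisVec_comp hh _) (bddMeas_basisVec_comp hh _)]
  rw [← integral_finsetSum _ fun j _ => (((bddMeas_basisVec_comp hh j).comp measurable_fst).mul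
    ((bddMeas_basisVec_comp hh j).comp (measurable_mix s))).integrable _,
    ← integral_indicator_one hm]
  simp only [sum_basisVec_mul]
  refine integral_congr_ae (Filter.Eventually.of_forall fun p => ?_)
  simp [basisVec, Set.indicator_apply]

lemma one_sub_noiseStab_eq (hh : Measurable h) (s : ℝ) :
    1 - noiseStab s h =
      ((gaussianPi ι).prod (gaussianPi ι)).real {p | h p.1 ≠ h (mix s p.1 p.2)} := by
  have hm : MeasurableSet {p : (ι → ℝ) × (ι → ℝ) | h p.1 = h (mix s p.1 p.2)} :=
    measurableSet_eq_fun (hh.comp measurable_fst) (hh.comp (measurable_mix s))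
  rw [noiseStab_eq_measureReal hh, ← probReal_compl_eq_one_sub hm]
  rfl

lemma noiseStab_le_one (hh : Measurable h) (s : ℝ) : noiseStab s h ≤ 1 := by
  rw [noiseStab_eq_measureReal hh]
  exact measureReal_le_one

lemma sum_integral_basisVec_mul_self (hh : Measurable h) :
    ∑ j, ∫ x, basisVec (h x) j * basisVec (h x) j ∂gaussianPi ι = 1 := by
  rw [← integral_finsetSum _ fun j _ =>
    ((bddMeas_basisVec_comp hh j).mul (bddMeas_basisVec_comp hh j)).integrable _]
  simp only [sum_basisVec_mul]
  simp [basisVec]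

lemma wAbove_le (hh : Measurable h) (hs : 0 ≤ s) {d : ℕ} (hd : Real.exp (-s) ^ (d + 1) ≤ 1 / 2) :
    wAbove d (fun x => basisVec (h x)) ≤ 2 * (1 - noiseStab s h) := by
  have hn : ∀ S : ι → ℕ, 0 ≤ ∑ j, hermCoeff (fun x => basisVec (h x) j) S ^ 2 := fun S =>
    Finset.sum_nonneg fun _ _ => sq_nonneg _
  have h0 : ∀ S : ι → ℕ, 0 ≤ 1 - Real.exp (-s) ^ (∑ i, S i) := fun S =>
    sub_nonneg.2 (pow_le_one₀ (Real.exp_nonneg _) (Real.exp_le_one_iff.2 (by linarith)))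
  refine Real.tsum_le_of_sum_le (fun S => ?_) fun T => ?_
  · split_ifs
    exacts [hn S, le_rfl]
  calc _ ≤ ∑ S ∈ T, 2 * ∑ j, (1 - Real.exp (-s) ^ (∑ i, S i)) *
        hermCoeff (fun x => basisVec (h x) j) S ^ 2 := by
        refine Finset.sum_le_sum fun S _ => ?_
        rw [← Finset.mul_sum]
        split_ifs with hS
        · have h1 : Real.exp (-s) ^ (∑ i, S i) ≤ 1 / 2 :=
            (pow_le_pow_of_le_one (Real.exp_nonneg _) (Real.exp_le_one_iff.2 (by linarith))
              hS).trans hd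
          nlinarith [hn S]
        · exact mul_nonneg zero_le_two (mul_nonneg (h0 S) (hn S))
    _ = 2 * ∑ j, ∑ S ∈ T, (1 - Real.exp (-s) ^ (∑ i, S i)) *
        hermCoeff (fun x => basisVec (h x) j) S ^ 2 := by
        rw [← Finset.mul_sum, Finset.sum_comm]
    _ ≤ 2 * ∑ j, (∫ x, basisVec (h x) j * basisVec (h x) j ∂gaussianPi ι -
        ∫ x, basisVec (h x) j * ouOp s (fun y => basisVec (h y) j) x ∂gaussianPi ι) := by
        gcongr with j
        exact sum_one_sub_exp_mul_hermCoeff_sq_le hs (bddMeas_basisVec_comp hh j) T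
    _ = 2 * (1 - noiseStab s h) := by
        rw [Finset.sum_sub_distrib, sum_integral_basisVec_mul_self hh, noiseStab_eq_sum hh]

end NoiseStability

section Partition

variable {ι Ω : Type*} [Fintype ι] [Nonempty ι] [MeasurableSpace Ω]

lemma exists_measurable_argmax [MeasurableSpace ι] {F : Ω → ι → ℝ}
    (hF : ∀ i, Measurable fun ω => F ω i) :
    ∃ h : Ω → ι, Measurable h ∧ ∀ ω i, F ω i ≤ F ω (h ω) := by
  obtain ⟨φ, hφ⟩ := exists_surjective_nat ι
  have hp : ∀ ω, ∃ N, ∀ i, F ω i ≤ F ω (φ N) := fun ω => by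
    obtain ⟨i, hi⟩ := Finite.exists_max (F ω)
    obtain ⟨N, rfl⟩ := hφ i
    exact ⟨N, hi⟩
  refine ⟨fun ω => φ (Nat.find (hp ω)), (measurable_from_nat (f := φ)).comp
    (measurable_find hp fun N => ?_), fun ω => Nat.find_spec (hp ω)⟩
  rw [Set.ofPred_forall]
  exact MeasurableSet.iInter fun i => measurableSet_le (hF i) (hF _)

/-- The largest of the shifted values `G i - z i`. -/
def shiftedMax (G z : ι → ℝ) : ℝ := Finset.univ.sup' Finset.univ_nonempty fun i => G i - z i

lemma sub_le_shiftedMax (G z : ι → ℝ) (i : ι) : G i - z i ≤ shiftedMax G z :=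
  Finset.le_sup' (fun i => G i - z i) (Finset.mem_univ i)

lemma shiftedMax_le_iff {G z : ι → ℝ} {c : ℝ} : shiftedMax G z ≤ c ↔ ∀ i, G i - z i ≤ c := by
  simp [shiftedMax]

lemma shiftedMax_le_add_norm (G z w : ι → ℝ) : shiftedMax G z ≤ shiftedMax G w + ‖w - z‖ := by
  refine shiftedMax_le_iff.2 fun i => ?_
  have h1 := sub_le_shiftedMax G w i
  have h2 := (le_abs_self _).trans (norm_le_pi_norm (w - z) i)
  simp only [Pi.sub_apply] at h2
  linarith

lemma abs_shiftedMax_le (G z : ι → ℝ) : |shiftedMax G z| ≤ ∑ i, |G i| + ‖z‖ := by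
  have hG : ∀ i, |G i| ≤ ∑ i, |G i| := fun i =>
    Finset.single_le_sum (f := fun i => |G i|) (fun _ _ => abs_nonneg _) (Finset.mem_univ i)
  have hz : ∀ i, |z i| ≤ ‖z‖ := norm_le_pi_norm z
  rw [abs_le]
  constructor
  · obtain ⟨i⟩ := ‹Nonempty ι›
    have := sub_le_shiftedMax G z i
    linarith [neg_abs_le (G i), le_abs_self (z i), hG i, hz i]
  · refine shiftedMax_le_iff.2 fun i => ?_
    linarith [le_abs_self (G i), neg_abs_le (z i), hG i, hz i]

lemma shiftedMax_add_const (G z : ι → ℝ) (c : ℝ) :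
    shiftedMax G (fun i => z i + c) = shiftedMax G z - c := by
  refine le_antisymm (shiftedMax_le_iff.2 fun i => ?_) ?_
  · linarith [sub_le_shiftedMax G z i]
  · rw [sub_le_iff_le_add]
    refine shiftedMax_le_iff.2 fun i => ?_
    linarith [sub_le_shiftedMax G (fun i => z i + c) i]

variable {μ : Measure Ω} [IsProbabilityMeasure μ] {G : Ω → ι → ℝ} {m : ι → ℝ}

lemma integrable_shiftedMax (hG : ∀ i, Measurable fun ω => G ω i)
    (hGi : ∀ i, Integrable (fun ω => G ω i) μ) (z : ι → ℝ) :
    Integrable (fun ω => shiftedMax (G ω) z) μ := by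
  refine Integrable.mono' (g := fun ω => ∑ i, |G ω i| + ‖z‖)
    ((integrable_finsetSum _ fun i _ => (hGi i).abs).add (integrable_const _)) ?_
    (Filter.Eventually.of_forall fun ω => abs_shiftedMax_le _ _)
  refine Measurable.aestronglyMeasurable ?_
  convert Finset.measurable_sup' (Finset.univ_nonempty (α := ι)) (f := fun i ω => G ω i - z i)
    (fun i _ => (hG i).sub_const _) using 1
  ext ω
  simp [shiftedMax]

/-- Existence of an optimal dual vector for partitions with prescribed masses. -/
lemma exists_minimizer_shiftedMax (hG : ∀ i, Measurable fun ω => G ω i)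
    (hGi : ∀ i, Integrable (fun ω => G ω i) μ) (hm : ∀ i, 0 < m i) (hm1 : ∑ i, m i = 1) :
    ∃ z : ι → ℝ, ∀ w : ι → ℝ, ∫ ω, shiftedMax (G ω) z ∂μ + ∑ i, m i * z i ≤
      ∫ ω, shiftedMax (G ω) w ∂μ + ∑ i, m i * w i := by
  set Φ : (ι → ℝ) → ℝ := fun z => ∫ ω, shiftedMax (G ω) z ∂μ + ∑ i, m i * z i with hΦ
  have hint := integrable_shiftedMax hG hGi
  have hle : ∀ z w : ι → ℝ, ∫ ω, shiftedMax (G ω) z ∂μ ≤ ∫ ω, shiftedMax (G ω) w ∂μ + ‖w - z‖ :=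
    fun z w => by
      calc _ ≤ ∫ ω, (shiftedMax (G ω) w + ‖w - z‖) ∂μ :=
            integral_mono (hint z) ((hint w).add (integrable_const _)) fun ω =>
              shiftedMax_le_add_norm _ _ _
        _ = _ := by rw [integral_add (hint w) (integrable_const _)]; simp
  have hcont : Continuous Φ := by
    refine Continuous.add ?_ (by fun_prop)
    refine (LipschitzWith.of_le_add fun z w => ?_).continuous
    rw [dist_eq_norm, ← norm_neg, neg_sub]
    exact hle z w
  have hshift : ∀ z c, Φ (fun i => z i + c) = Φ z := fun z c => by
    simp only [hΦ, shiftedMax_add_const, mul_add, Finset.sum_add_distrib, ← Finset.sum_mul, hm1]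
    rw [integral_sub (hint z) (integrable_const _)]
    simp
  set C := ∫ ω, ∑ i, |G ω i| ∂μ with hC
  have hCi : Integrable (fun ω => ∑ i, |G ω i|) μ := integrable_finsetSum _ fun i _ => (hGi i).abs
  have hC0 : 0 ≤ C := integral_nonneg fun ω => Finset.sum_nonneg fun _ _ => abs_nonneg _
  have hΦ0 : Φ 0 ≤ C := by
    simp only [hΦ, Pi.zero_apply, mul_zero, Finset.sum_const_zero, add_zero]
    refine integral_mono (hint 0) hCi fun ω => ?_
    simpa using (le_abs_self _).trans (abs_shiftedMax_le (G ω) 0)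
  set R := ∑ i, 2 * C / m i with hR
  have hRi : ∀ i, 2 * C ≤ m i * R := fun i => by
    have h1 : 2 * C / m i ≤ R := Finset.single_le_sum (f := fun i => 2 * C / m i)
      (fun i _ => div_nonneg (by linarith) (hm i).le) (Finset.mem_univ i)
    rw [div_le_iff₀ (hm i)] at h1
    linarith
  have hR0 : 0 ≤ R := Finset.sum_nonneg fun i _ => div_nonneg (by linarith) (hm i).le
  obtain ⟨z, -, hz⟩ := (isCompact_Icc (a := (0 : ι → ℝ)) (b := fun _ => R)).exists_isMinOn
    ⟨0, le_rfl, fun _ => hR0⟩ hcont.continuousOn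
  refine ⟨z, fun w => ?_⟩
  obtain ⟨i₀, hi₀⟩ := Finite.exists_min w
  change Φ z ≤ Φ w
  rw [← hshift w (-w i₀)]
  set w' : ι → ℝ := fun i => w i + -w i₀ with hw'
  have hw0 : ∀ i, 0 ≤ w' i := fun i => by simp only [hw']; linarith [hi₀ i]
  have hwi₀ : w' i₀ = 0 := by simp [hw']
  by_cases hB : ∀ i, w' i ≤ R
  · exact hz ⟨fun i => hw0 i, hB⟩
  · push Not at hB
    obtain ⟨i, hi⟩ := hB
    have h1 : Φ z ≤ Φ 0 := hz ⟨le_rfl, fun _ => hR0⟩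
    have h2 : m i * w' i ≤ ∑ i, m i * w' i := Finset.single_le_sum (f := fun i => m i * w' i)
      (fun i _ => mul_nonneg (hm i).le (hw0 i)) (Finset.mem_univ i)
    have h3 : -C ≤ ∫ ω, shiftedMax (G ω) w' ∂μ := by
      rw [hC, ← integral_neg]
      refine integral_mono hCi.neg (hint w') fun ω => ?_
      have h4 := sub_le_shiftedMax (G ω) w' i₀
      have h5 : |G ω i₀| ≤ ∑ i, |G ω i| :=
        Finset.single_le_sum (f := fun i => |G ω i|) (fun _ _ => abs_nonneg _)
          (Finset.mem_univ i₀)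
      change -∑ i, |G ω i| ≤ _
      linarith [neg_abs_le (G ω i₀)]
    have h6 : m i * R ≤ m i * w' i := mul_le_mul_of_nonneg_left hi.le (hm i).le
    have h7 : Φ w' = ∫ ω, shiftedMax (G ω) w' ∂μ + ∑ i, m i * w' i := rfl
    linarith [hRi i]

lemma exists_partition_of_pos [MeasurableSpace ι] [MeasurableSingletonClass ι]
    (hG : ∀ i, Measurable fun ω => G ω i)
    (hGi : ∀ i, Integrable (fun ω => G ω i) μ) (hm : ∀ i, 0 < m i) (hm1 : ∑ i, m i = 1)
    (hties : ∀ i j, i ≠ j → ∀ w : ℝ, μ {ω | G ω i - G ω j = w} = 0) :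
    ∃ (z : ι → ℝ) (h : Ω → ι), Measurable h ∧ (∀ ω i, G ω i - z i ≤ G ω (h ω) - z (h ω)) ∧
      ∀ i, μ.real {ω | h ω = i} = m i := by
  obtain ⟨z, hz⟩ := exists_minimizer_shiftedMax hG hGi hm hm1
  obtain ⟨h, hh, hmax⟩ := exists_measurable_argmax (F := fun ω i => G ω i - z i)
    fun i => (hG i).sub_const _
  refine ⟨z, h, hh, hmax, ?_⟩
  have hint := integrable_shiftedMax hG hGi
  have hmeas : ∀ i, MeasurableSet {ω | h ω = i} := fun i => hh (measurableSet_singleton i)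
  have hNle : ∀ i (τ : ℝ), 0 < τ →
      μ.real {ω | ∀ j, j ≠ i → G ω j - z j ≤ G ω i - z i - τ} ≤ m i := fun i τ hτ => by
    set A := {ω | ∀ j, j ≠ i → G ω j - z j ≤ G ω i - z i - τ} with hA
    have hAm : MeasurableSet A := by
      simp only [hA, Set.ofPred_forall]
      exact MeasurableSet.iInter fun j => MeasurableSet.iInter fun _ =>
        measurableSet_le ((hG j).sub_const _) (((hG i).sub_const _).sub_const _)
    set w : ι → ℝ := Function.update z i (z i + τ) with hw
    have hwi : w i = z i + τ := by simp [hw]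
    have hwj : ∀ j, j ≠ i → w j = z j := fun j hj => by simp [hw, hj]
    have hpt : ∀ ω, shiftedMax (G ω) w ≤ shiftedMax (G ω) z - τ * A.indicator 1 ω := fun ω => by
      refine shiftedMax_le_iff.2 fun j => ?_
      by_cases hω : ω ∈ A
      · simp only [Set.indicator_of_mem hω, Pi.one_apply, mul_one]
        have h1 := sub_le_shiftedMax (G ω) z i
        rcases eq_or_ne j i with rfl | hj
        · rw [hwi]; linarith
        · rw [hwj j hj]; linarith [hω j hj]
      · simp only [Set.indicator_of_notMem hω, mul_zero, sub_zero]
        have h1 := sub_le_shiftedMax (G ω) z j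
        rcases eq_or_ne j i with rfl | hj
        · rw [hwi]; linarith
        · rwa [hwj j hj]
    have hind : Integrable (fun ω => τ * A.indicator (1 : Ω → ℝ) ω) μ :=
      ((integrable_const 1).indicator hAm).const_mul τ
    have h2 := integral_mono (hint w) ((hint z).sub hind) hpt
    simp only [Pi.sub_apply] at h2
    rw [integral_sub (hint z) hind, integral_const_mul, integral_indicator_one hAm] at h2
    have h3 : ∑ j, m j * w j = ∑ j, m j * z j + m i * τ := by
      have : ∀ j, m j * w j = m j * z j + if j = i then m i * τ else 0 := fun j => by
        rcases eq_or_ne j i with rfl | hj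
        · simp [hwi, mul_add]
        · simp [hwj j hj, hj]
      simp [this, Finset.sum_add_distrib]
    have h4 := hz w
    nlinarith
  have hle : ∀ i, μ.real {ω | h ω = i} ≤ m i := fun i => by
    set A : ℕ → Set Ω := fun n => {ω | ∀ j, j ≠ i → G ω j - z j ≤ G ω i - z i - 1 / ((n : ℝ) + 1)}
      with hA
    have hmono : Monotone A := fun a b hab ω hω j hj => by
      have := Nat.one_div_le_one_div (α := ℝ) hab
      linarith [hω j hj]
    have h1 : μ (⋃ n, A n) ≤ ENNReal.ofReal (m i) := by
      rw [hmono.measure_iUnion]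
      refine iSup_le fun n => ?_
      rw [← ofReal_measureReal]
      exact ENNReal.ofReal_le_ofReal (hNle i _ Nat.one_div_pos_of_nat)
    have hsub : {ω | h ω = i} ⊆
        (⋃ n, A n) ∪ ⋃ j : {j // j ≠ i}, {ω | G ω i - G ω j.1 = z i - z j.1} := fun ω hω => by
      by_cases ht : ∃ j, j ≠ i ∧ G ω i - G ω j = z i - z j
      · obtain ⟨j, hj, hj'⟩ := ht
        exact Or.inr (Set.mem_iUnion.2 ⟨⟨j, hj⟩, hj'⟩)
      · push Not at ht
        left
        have hlt : ∀ j, j ≠ i → ∃ n : ℕ, 1 / ((n : ℝ) + 1) < (G ω i - z i) - (G ω j - z j) :=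
          fun j hj => by
            refine exists_nat_one_div_lt (lt_of_le_of_ne ?_ fun h0 => ht j hj (by linarith))
            have := hmax ω j
            rw [hω] at this
            linarith
        choose! n hn using hlt
        refine Set.mem_iUnion.2 ⟨Finset.univ.sup n, fun j hj => ?_⟩
        have := Nat.one_div_le_one_div (α := ℝ) (Finset.le_sup (f := n) (Finset.mem_univ j))
        linarith [hn j hj]
    have h2 : μ {ω | h ω = i} ≤ ENNReal.ofReal (m i) := by
      refine (measure_mono hsub).trans ((measure_union_le _ _).trans ?_)
      rw [measure_iUnion_null fun j : {j // j ≠ i} => hties i j.1 j.2.symm _, add_zero]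
      exact h1
    exact ENNReal.toReal_le_of_le_ofReal (hm i).le h2
  have hsum : ∑ i, μ.real {ω | h ω = i} = 1 := by
    have := sum_measureReal_preimage_singleton (μ := μ) (f := h) Finset.univ
      (fun i _ => hmeas i)
    simpa [Set.preimage] using this
  intro i
  have := (Finset.sum_eq_sum_iff_of_le fun i _ => hle i).1 (hsum.trans hm1.symm)
  exact this i (Finset.mem_univ i)

end Partition

section Rounding

variable {Ω : Type*} [MeasurableSpace Ω] {μ : Measure Ω} {k : ℕ}

/-- Partitions with prescribed masses, some of which may vanish. -/
lemma exists_partition [IsProbabilityMeasure μ] {G : Ω → Fin k → ℝ} {m : Fin k → ℝ}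
    (hG : ∀ i, Measurable fun ω => G ω i)
    (hGi : ∀ i, Integrable (fun ω => G ω i) μ) (hm : ∀ i, 0 ≤ m i) (hm1 : ∑ i, m i = 1)
    (hties : ∀ i j, i ≠ j → ∀ w : ℝ, μ {ω | G ω i - G ω j = w} = 0) :
    ∃ (z : Fin k → ℝ) (h : Ω → Fin k), Measurable h ∧
      (∀ ω i, 0 < m i → G ω i - z i ≤ G ω (h ω) - z (h ω)) ∧ (∀ ω, 0 < m (h ω)) ∧
      ∀ i, μ.real {ω | h ω = i} = m i := by
  have hsum : ∑ i : {i // 0 < m i}, m i = 1 := by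
    rw [← hm1, ← Finset.sum_filter_of_ne (p := fun i => 0 < m i)
      fun i _ hi => lt_of_le_of_ne (hm i) hi.symm]
    exact (Finset.sum_subtype _ (by simp) _).symm
  have : Nonempty {i // 0 < m i} := by
    by_contra hne
    rw [not_nonempty_iff] at hne
    simp at hsum
  obtain ⟨z, h, hh, hmax, hmass⟩ := exists_partition_of_pos (μ := μ) (ι := {i // 0 < m i})
    (G := fun ω i => G ω i) (m := fun i => m i) (fun i => hG i) (fun i => hGi i) (fun i => i.2)
    hsum (fun i j hij w => hties i j (fun h => hij (Subtype.ext h)) w)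
  refine ⟨fun i => if hi : 0 < m i then z ⟨i, hi⟩ else 0, fun ω => h ω,
    measurable_subtype_coe.comp hh, fun ω i hi => ?_, fun ω => (h ω).2, fun i => ?_⟩
  · simpa [hi, (h ω).2] using hmax ω ⟨i, hi⟩
  · by_cases hi : 0 < m i
    · rw [← hmass ⟨i, hi⟩]
      congr 1
      ext ω
      exact (Subtype.ext_iff (a1 := h ω) (a2 := ⟨i, hi⟩)).symm
    · have h0 : {ω | (h ω : Fin k) = i} = ∅ := by
        ext ω
        simp only [Set.mem_ofPred_eq, Set.mem_empty_iff_false, iff_false]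
        rintro rfl
        exact hi (h ω).2
      rw [h0, measureReal_empty]
      linarith [hm i]

lemma integrable_apply_comp {G : Ω → Fin k → ℝ}
    (hGi : ∀ i, Integrable (fun ω => G ω i) μ) {g : Ω → Fin k} (hg : Measurable g) :
    Integrable (fun ω => G ω (g ω)) μ := by
  have h : ∀ ω, G ω (g ω) = ∑ j, basisVec (g ω) j * G ω j := fun ω =>
    (sum_basisVec_mul _ _).symm
  simp only [h]
  exact integrable_finsetSum _ fun j _ => (hGi j).bdd_mul
    (measurable_basisVec_comp hg j).aestronglyMeasurable
    (Filter.Eventually.of_forall fun ω => abs_basisVec_le_one (g ω) j)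

lemma integral_basisVec_comp {g : Ω → Fin k} (hg : Measurable g) (j : Fin k) :
    ∫ ω, basisVec (g ω) j ∂μ = μ.real {ω | g ω = j} := by
  rw [← integral_indicator_one (show MeasurableSet {ω | g ω = j} from
    hg (measurableSet_singleton j))]
  congr 1
  ext ω
  simp [basisVec, Set.indicator_apply, eq_comm]

lemma integral_const_comp [IsProbabilityMeasure μ] {g : Ω → Fin k} (hg : Measurable g)
    (z : Fin k → ℝ) :
    ∫ ω, z (g ω) ∂μ = ∑ i, μ.real {ω | g ω = i} * z i := by
  have h : ∀ ω, z (g ω) = ∑ j, basisVec (g ω) j * z j := fun ω => (sum_basisVec_mul _ _).symm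
  simp only [h]
  rw [integral_finsetSum _ fun j _ => ((bddMeas_basisVec_comp hg j).integrable μ).mul_const _]
  refine Finset.sum_congr rfl fun j _ => ?_
  rw [integral_mul_const, integral_basisVec_comp hg]

/-- Thresholding maximizes the linear functional among partitions with the same masses. -/
lemma integral_apply_comp_le [IsProbabilityMeasure μ] {G : Ω → Fin k → ℝ} {m z : Fin k → ℝ}
    (hGi : ∀ i, Integrable (fun ω => G ω i) μ) {g h : Ω → Fin k} (hg : Measurable g)
    (hh : Measurable h) (hm : ∀ i, 0 ≤ m i)
    (hmax : ∀ ω i, 0 < m i → G ω i - z i ≤ G ω (h ω) - z (h ω))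
    (hgm : ∀ i, μ.real {ω | g ω = i} = m i) (hhm : ∀ i, μ.real {ω | h ω = i} = m i) :
    ∫ ω, G ω (g ω) ∂μ ≤ ∫ ω, G ω (h ω) ∂μ := by
  have hz : ∀ {g : Ω → Fin k}, Measurable g → Integrable (fun ω => z (g ω)) μ := fun hg =>
    integrable_apply_comp (G := fun _ => z) (fun _ => integrable_const _) hg
  have hpos : ∀ᵐ ω ∂μ, 0 < m (g ω) := by
    have h0 : ∀ i, ∀ᵐ ω ∂μ, g ω = i → 0 < m i := fun i => by
      rcases (hm i).eq_or_lt with hi | hi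
      · have h0 := hgm i
        rw [← hi, measureReal_eq_zero_iff] at h0
        exact (measure_eq_zero_iff_ae_notMem.1 h0).mono fun ω hω hgω => absurd hgω hω
      · exact Filter.Eventually.of_forall fun _ _ => hi
    filter_upwards [ae_all_iff.2 h0] with ω hω using hω _ rfl
  have h1 : ∫ ω, (G ω (g ω) - z (g ω)) ∂μ ≤ ∫ ω, (G ω (h ω) - z (h ω)) ∂μ :=
    integral_mono_ae ((integrable_apply_comp hGi hg).sub (hz hg))
      ((integrable_apply_comp hGi hh).sub (hz hh)) (hpos.mono fun ω hω => hmax ω _ hω)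
  rw [integral_sub (integrable_apply_comp hGi hg) (hz hg),
    integral_sub (integrable_apply_comp hGi hh) (hz hh), integral_const_comp hg,
    integral_const_comp hh] at h1
  simp only [hgm, hhm] at h1
  linarith

/-- Two points rounded differently are near a decision boundary or far apart. -/
lemma measureReal_ne_le {G : Ω → Fin k → ℝ} {m z : Fin k → ℝ} {h : Ω → Fin k} {Ω' : Type*}
    [MeasurableSpace Ω'] {ν : Measure Ω'} [IsProbabilityMeasure ν] {X Y : Ω' → Ω}
    (hX : MeasurePreserving X ν μ) (hG : ∀ i, Measurable fun ω => G ω i)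
    (hmax : ∀ ω i, 0 < m i → G ω i - z i ≤ G ω (h ω) - z (h ω)) (hpos : ∀ ω, 0 < m (h ω))
    (θ : ℝ) {b : ℝ}
    (hb : ∀ i j, i ≠ j → ∀ w : ℝ, μ.real {ω | |G ω i - G ω j - w| ≤ θ} ≤ b) (hb0 : 0 ≤ b) :
    ν.real {p | h (X p) ≠ h (Y p)} ≤
      k * k * b + ∑ i, ν.real {p | θ / 2 ≤ |G (X p) i - G (Y p) i|} := by
  set A : Fin k → Fin k → Set Ω' := fun i j =>
    if i = j then ∅ else {p | |G (X p) i - G (X p) j - (z i - z j)| ≤ θ} with hA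
  set B : Fin k → Set Ω' := fun i => {p | θ / 2 ≤ |G (X p) i - G (Y p) i|} with hB
  have hsub : {p | h (X p) ≠ h (Y p)} ⊆ (⋃ i, ⋃ j, A i j) ∪ ⋃ i, B i := by
    intro p hp
    by_contra hcon
    simp only [Set.mem_union, Set.mem_iUnion, not_or, not_exists] at hcon
    obtain ⟨h1, h2⟩ := hcon
    have hp' : h (X p) ≠ h (Y p) := hp
    have h3 := h1 (h (X p)) (h (Y p))
    simp only [hA, if_neg hp', Set.mem_ofPred_eq, not_le] at h3
    simp only [hB, Set.mem_ofPred_eq, not_le] at h2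
    have h4 := hmax (X p) _ (hpos (Y p))
    have h5 := hmax (Y p) _ (hpos (X p))
    have h6 := abs_lt.1 (h2 (h (X p)))
    have h7 := abs_lt.1 (h2 (h (Y p)))
    rw [abs_of_nonneg (by linarith)] at h3
    linarith [h6.1, h6.2, h7.1, h7.2]
  have hAle : ∀ i j, ν.real (A i j) ≤ b := fun i j => by
    by_cases hij : i = j
    · simp [hA, hij, hb0]
    · simp only [hA, if_neg hij]
      refine le_trans (le_of_eq ?_) (hb i j hij (z i - z j))
      exact hX.measureReal_preimage (s := {ω | |G ω i - G ω j - (z i - z j)| ≤ θ})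
        (measurableSet_le ((((hG i).sub (hG j)).sub_const _).abs)
          measurable_const).nullMeasurableSet
  calc _ ≤ ν.real ((⋃ i, ⋃ j, A i j) ∪ ⋃ i, B i) := measureReal_mono hsub
    _ ≤ ν.real (⋃ i, ⋃ j, A i j) + ν.real (⋃ i, B i) := measureReal_union_le _ _
    _ ≤ ∑ i : Fin k, ∑ j : Fin k, b + ∑ i, ν.real (B i) := by
        refine add_le_add ((measureReal_iUnion_fintype_le _).trans
          (Finset.sum_le_sum fun i _ => (measureReal_iUnion_fintype_le _).trans
          (Finset.sum_le_sum fun j _ => hAle i j))) (measureReal_iUnion_fintype_le _)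
    _ = _ := by simp [hB, mul_assoc]

end Rounding

section AntiConcentration

lemma lintegral_measure_abs_add_mul_le {Ω : Type*} [MeasurableSpace Ω] {ν : Measure Ω}
    [IsProbabilityMeasure ν] {A B : Ω → ℝ} (hA : Measurable A) (hB : Measurable B) {r θ : ℝ}
    (hr : 0 < r) :
    ∫⁻ c in Set.Icc (0 : ℝ) 1, ν {ω | |A ω + c * B ω| ≤ θ} ≤
      ν {ω | |B ω| < r} + ENNReal.ofReal (2 * θ / r) := by
  set ρ := (volume : Measure ℝ).restrict (Set.Icc 0 1)
  have hρ : ρ Set.univ = 1 := by simp [ρ]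
  set S : Set (Ω × ℝ) := {p | |A p.1 + p.2 * B p.1| ≤ θ} with hS
  have hSm : MeasurableSet S := measurableSet_le (by fun_prop) measurable_const
  have hBm : MeasurableSet {ω | |B ω| < r} := measurableSet_lt (by fun_prop) measurable_const
  have e1 : ∫⁻ c, ν {ω | |A ω + c * B ω| ≤ θ} ∂ρ = ∫⁻ ω, ρ {c | |A ω + c * B ω| ≤ θ} ∂ν :=
    (Measure.prod_apply_symm (μ := ν) (ν := ρ) hSm).symm.trans (Measure.prod_apply hSm)
  have hpt : ∀ ω, ρ {c | |A ω + c * B ω| ≤ θ} ≤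
      ({ω | |B ω| < r}).indicator 1 ω + ENNReal.ofReal (2 * θ / r) := fun ω => by
    by_cases hω : |B ω| < r
    · rw [Set.indicator_of_mem (show ω ∈ {ω | |B ω| < r} from hω), Pi.one_apply]
      exact (measure_mono (Set.subset_univ _)).trans (hρ.le.trans le_self_add)
    · rw [Set.indicator_of_notMem (show ω ∉ {ω | |B ω| < r} from hω), zero_add]
      have hBr : r ≤ |B ω| := not_lt.1 hω
      have hB0 : 0 < |B ω| := hr.trans_le hBr
      have hBne : B ω ≠ 0 := abs_pos.1 hB0
      have hsub : {c | |A ω + c * B ω| ≤ θ} ⊆ Metric.closedBall (-A ω / B ω) (θ / r) := by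
        intro c hc
        have hc' : |A ω + c * B ω| ≤ θ := hc
        have e2 : A ω + c * B ω = (c - -A ω / B ω) * B ω := by field_simp; ring
        rw [e2, abs_mul] at hc'
        rw [Metric.mem_closedBall, Real.dist_eq, le_div_iff₀ hr]
        exact (mul_le_mul_of_nonneg_left hBr (abs_nonneg _)).trans hc'
      calc ρ {c | |A ω + c * B ω| ≤ θ} ≤ volume (Metric.closedBall (-A ω / B ω) (θ / r)) :=
            (Measure.restrict_apply_le _ _).trans (measure_mono hsub)
        _ = ENNReal.ofReal (2 * θ / r) := by rw [Real.volume_closedBall, mul_div_assoc]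
  rw [e1]
  calc _ ≤ ∫⁻ ω, (({ω | |B ω| < r}).indicator 1 ω + ENNReal.ofReal (2 * θ / r)) ∂ν :=
        lintegral_mono hpt
    _ = _ := by
        rw [lintegral_add_right _ measurable_const, lintegral_indicator_one hBm]
        simp

lemma gaussianReal_le_volume (s : Set ℝ) : gaussianReal 0 1 s ≤ volume s := by
  rw [gaussianReal_apply _ one_ne_zero]
  calc ∫⁻ x in s, gaussianPDF 0 1 x ≤ ∫⁻ _ in s, 1 := by
        refine lintegral_mono fun x => ?_
        rw [gaussianPDF, gaussianPDFReal]
        refine ENNReal.ofReal_le_one.2 (mul_le_one₀ (inv_le_one_of_one_le₀ ?_)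
          (Real.exp_nonneg _) (Real.exp_le_one_iff.2 ?_))
        · rw [Real.one_le_sqrt]
          simp
          linarith [Real.pi_gt_three]
        · have : 0 ≤ (x - 0) ^ 2 / (2 * ((1 : NNReal) : ℝ)) := by positivity
          rw [neg_div]
          linarith
    _ = volume s := by simp

variable {ι : Type*} [Fintype ι]

lemma measure_abs_coord_sub_lt_le (i : ι) (r : ℝ) :
    ((gaussianPi ι).prod (gaussianPi ι)) {p | |p.1 i - p.2 i| < r} ≤ ENNReal.ofReal (2 * r) := by
  have hm : MeasurableSet {p : (ι → ℝ) × (ι → ℝ) | |p.1 i - p.2 i| < r} :=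
    measurableSet_lt (by fun_prop) measurable_const
  rw [Measure.prod_apply hm]
  have hpt : ∀ x : ι → ℝ, gaussianPi ι (Prod.mk x ⁻¹' {p | |p.1 i - p.2 i| < r}) ≤
      ENNReal.ofReal (2 * r) := fun x => by
    have he : MeasurePreserving (fun y : ι → ℝ => y i) (gaussianPi ι) (gaussianReal 0 1) :=
      measurePreserving_eval _ i
    have hset : Prod.mk x ⁻¹' {p : (ι → ℝ) × (ι → ℝ) | |p.1 i - p.2 i| < r} =
        (fun y : ι → ℝ => y i) ⁻¹' Metric.ball (x i) r := by
      ext y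
      simp [Real.dist_eq, abs_sub_comm]
    rw [hset, he.measure_preimage Metric.isOpen_ball.measurableSet.nullMeasurableSet]
    exact (gaussianReal_le_volume _).trans (Real.volume_ball _ _).le
  calc _ ≤ ∫⁻ _, ENNReal.ofReal (2 * r) ∂gaussianPi ι := lintegral_mono hpt
    _ = _ := by simp

/-- Adding a multiple of the `i₀`-th coordinate, with distinct slopes for distinct components. -/
def tilt {k : ℕ} (F : (ι → ℝ) → Fin k → ℝ) (i₀ : ι) (a : ℝ) (x : ι → ℝ) (i : Fin k) : ℝ :=
  F x i + a * i * x i₀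

/-- A random linear tilt makes all the differences of the components of `F` spread out. -/
lemma exists_tilt {k : ℕ} {F : (ι → ℝ) → Fin k → ℝ} (hF : ∀ i, Measurable fun x => F x i)
    (i₀ : ι) {η r θ : ℝ} (hη : 0 < η) (hr : 0 < r) (hθ : 0 ≤ θ) :
    ∃ a ∈ Set.Icc (0 : ℝ) η, ∀ i j, i ≠ j →
      (gaussianPi ι).prod (gaussianPi ι)
        {p | |(tilt F i₀ a p.1 i - tilt F i₀ a p.1 j) -
          (tilt F i₀ a p.2 i - tilt F i₀ a p.2 j)| ≤ θ} ≤
            ENNReal.ofReal (k * k * (2 * r + 2 * θ / (η * r))) ∧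
      (gaussianPi ι).prod (gaussianPi ι)
        {p | |(tilt F i₀ a p.1 i - tilt F i₀ a p.1 j) -
          (tilt F i₀ a p.2 i - tilt F i₀ a p.2 j)| ≤ 0} = 0 := by
  set ν := (gaussianPi ι).prod (gaussianPi ι)
  set ρ := (volume : Measure ℝ).restrict (Set.Icc 0 1) with hρdef
  have hρ : IsProbabilityMeasure ρ := ⟨by simp [ρ]⟩
  set A : Fin k → Fin k → (ι → ℝ) × (ι → ℝ) → ℝ := fun i j p =>
    (F p.1 i - F p.1 j) - (F p.2 i - F p.2 j) with hA
  set B : Fin k → Fin k → (ι → ℝ) × (ι → ℝ) → ℝ := fun i j p =>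
    η * (i - j) * (p.1 i₀ - p.2 i₀) with hB
  have hAm : ∀ i j, Measurable (A i j) := fun i j =>
    (((hF i).comp measurable_fst).sub ((hF j).comp measurable_fst)).sub
      (((hF i).comp measurable_snd).sub ((hF j).comp measurable_snd))
  have hBm : ∀ i j, Measurable (B i j) := fun i j => by simp only [hB]; fun_prop
  have hkey : ∀ i j, i ≠ j → ∀ r > 0, ∀ θ ≥ 0, ∫⁻ c, ν {p | |A i j p + c * B i j p| ≤ θ} ∂ρ ≤
      ENNReal.ofReal (2 * r + 2 * θ / (η * r)) := fun i j hij r hr θ hθ => by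
    refine (lintegral_measure_abs_add_mul_le (hAm i j) (hBm i j) (mul_pos hη hr)).trans ?_
    rw [ENNReal.ofReal_add (by positivity) (by positivity)]
    gcongr
    refine le_trans (measure_mono fun p hp => ?_) (measure_abs_coord_sub_lt_le i₀ r)
    have hp' : |η * (i - j) * (p.1 i₀ - p.2 i₀)| < η * r := hp
    have hij' : (1 : ℝ) ≤ |(i : ℝ) - j| := by
      have h1 : (i : ℤ) - (j : ℤ) ≠ 0 := by
        intro h; apply hij; ext; omega
      have := Int.one_le_abs h1
      exact_mod_cast this
    rw [abs_mul, abs_mul, abs_of_pos hη, mul_assoc] at hp'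
    have := lt_of_mul_lt_mul_left hp' hη.le
    change |p.1 i₀ - p.2 i₀| < r
    nlinarith [abs_nonneg (p.1 i₀ - p.2 i₀)]
  have hmeas : ∀ i j θ, Measurable fun c : ℝ => ν {p | |A i j p + c * B i j p| ≤ θ} :=
    fun i j θ => by
      have hSm : MeasurableSet {q : ((ι → ℝ) × (ι → ℝ)) × ℝ |
          |A i j q.1 + q.2 * B i j q.1| ≤ θ} :=
        measurableSet_le ((((hAm i j).comp measurable_fst).add
          (measurable_snd.mul ((hBm i j).comp measurable_fst))).abs) measurable_const
      exact measurable_measure_prodMk_right hSm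
  have hnull : ∀ᵐ c ∂ρ, ∀ i j, i ≠ j → ν {p | |A i j p + c * B i j p| ≤ 0} = 0 := by
    refine ae_all_iff.2 fun i => ae_all_iff.2 fun j => ?_
    by_cases hij : i = j
    · exact Filter.Eventually.of_forall fun c h => absurd hij h
    have h0 : ∫⁻ c, ν {p | |A i j p + c * B i j p| ≤ 0} ∂ρ = 0 := by
      refine le_antisymm (ENNReal.le_of_forall_pos_le_add fun δ hδ _ => ?_) bot_le
      have := hkey i j hij (δ / 2) (by positivity) 0 le_rfl
      simpa [mul_div_cancel₀] using this
    exact ((lintegral_eq_zero_iff (hmeas i j 0)).1 h0).mono fun c hc _ => hc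
  have hmem : ∀ᵐ c ∂ρ, c ∈ Set.Icc (0 : ℝ) 1 := ae_restrict_mem measurableSet_Icc
  have hgood := hnull.and hmem
  set Q : ℝ → ENNReal := fun c => ∑ i, ∑ j, if i = j then 0 else
    ν {p | |A i j p + c * B i j p| ≤ θ} with hQ
  have hQm : Measurable Q :=
    Finset.measurable_sum _ fun i _ => Finset.measurable_sum _ fun j _ => by
      split_ifs
      exacts [measurable_const, hmeas i j θ]
  have hQle : ∫⁻ c, Q c ∂ρ ≤ ENNReal.ofReal (k * k * (2 * r + 2 * θ / (η * r))) := by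
    simp only [hQ]
    rw [lintegral_finsetSum _ fun i _ => Finset.measurable_sum _ fun j _ => by
      split_ifs
      exacts [measurable_const, hmeas i j θ]]
    calc _ ≤ ∑ i : Fin k, ∑ j : Fin k, ENNReal.ofReal (2 * r + 2 * θ / (η * r)) := by
          refine Finset.sum_le_sum fun i _ => ?_
          rw [lintegral_finsetSum _ fun j _ => by
            split_ifs
            exacts [measurable_const, hmeas i j θ]]
          refine Finset.sum_le_sum fun j _ => ?_
          split_ifs with hij
          · simp
          · exact hkey i j hij r hr θ hθ
      _ = _ := by
          rw [mul_assoc, ENNReal.ofReal_mul (by positivity), ENNReal.ofReal_mul (by positivity)]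
          simp
  obtain ⟨c, hc, hcle⟩ := exists_notMem_null_le_lintegral (μ := ρ) (f := Q) hQm.aemeasurable
    (ae_iff.1 hgood)
  simp only [Set.mem_ofPred_eq, not_not] at hc
  refine ⟨η * c, ⟨mul_nonneg hη.le hc.2.1, mul_le_of_le_one_right hη.le hc.2.2⟩,
    fun i j hij => ?_⟩
  have e : ∀ p : (ι → ℝ) × (ι → ℝ), (tilt F i₀ (η * c) p.1 i - tilt F i₀ (η * c) p.1 j) -
      (tilt F i₀ (η * c) p.2 i - tilt F i₀ (η * c) p.2 j) = A i j p + c * B i j p := fun p => by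
    simp only [tilt, hA, hB]; ring
  simp only [e]
  refine ⟨?_, hc.1 i j hij⟩
  refine le_trans ?_ (hcle.trans hQle)
  have h1 : ν {p | |A i j p + c * B i j p| ≤ θ} =
      if i = j then 0 else ν {p | |A i j p + c * B i j p| ≤ θ} := by rw [if_neg hij]
  rw [h1]
  exact (Finset.single_le_sum (f := fun j => if i = j then 0 else
    ν {p | |A i j p + c * B i j p| ≤ θ}) (fun _ _ => zero_le) (Finset.mem_univ j)).trans
    (Finset.single_le_sum (f := fun i => ∑ j, if i = j then 0 else
      ν {p | |A i j p + c * B i j p| ≤ θ}) (fun _ _ => zero_le) (Finset.mem_univ i))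

/-- The concentration function is controlled by the symmetrization. -/
lemma measure_abs_sub_le_sq_le {Ω : Type*} [MeasurableSpace Ω] {μ : Measure Ω} [SFinite μ]
    (Z : Ω → ℝ) (w θ : ℝ) :
    μ {ω | |Z ω - w| ≤ θ} ^ 2 ≤ (μ.prod μ) {p | |Z p.1 - Z p.2| ≤ 2 * θ} := by
  rw [sq, ← Measure.prod_prod]
  refine measure_mono fun p hp => ?_
  have h1 : |Z p.1 - w| ≤ θ := hp.1
  have h2 : |Z p.2 - w| ≤ θ := hp.2
  have h3 := abs_sub_le (Z p.1) w (Z p.2)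
  rw [abs_sub_comm w] at h3
  change |Z p.1 - Z p.2| ≤ 2 * θ
  linarith

end AntiConcentration

section Coordinates

variable {ι : Type*} [Fintype ι]

lemma memLp_coord (i : ι) : MemLp (fun x : ι → ℝ => x i) 2 (gaussianPi ι) :=
  (memLp_id_gaussianReal (μ := 0) (v := 1) 2).comp_measurePreserving
    (measurePreserving_eval (fun _ : ι => gaussianReal 0 1) i)

lemma integrable_coord (i : ι) : Integrable (fun x : ι → ℝ => x i) (gaussianPi ι) :=
  (memLp_coord i).integrable one_le_two

lemma integral_coord_mul_self (i : ι) : ∫ x : ι → ℝ, x i * x i ∂gaussianPi ι = 1 := by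
  have he : MeasurePreserving (fun y : ι → ℝ => y i) (gaussianPi ι) (gaussianReal 0 1) :=
    measurePreserving_eval _ i
  have h := integral_map (μ := gaussianPi ι) (φ := fun y => y i) (f := fun y : ℝ => y * y)
    he.measurable.aemeasurable (by fun_prop)
  rw [he.map_eq] at h
  rw [← h]
  simpa using integral_mul_polynomial_gaussianReal Polynomial.X

lemma integral_abs_coord_le_one (i : ι) : ∫ x : ι → ℝ, |x i| ∂gaussianPi ι ≤ 1 := by
  have hi : Integrable (fun x : ι → ℝ => x i * x i) (gaussianPi ι) :=
    (memLp_coord i).integrable_mul (memLp_coord i)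
  calc ∫ x : ι → ℝ, |x i| ∂gaussianPi ι
      ≤ ∫ x : ι → ℝ, (1 / 2 + 1 / 2 * (x i * x i)) ∂gaussianPi ι := by
        refine integral_mono (integrable_coord i).abs ((integrable_const _).add (hi.const_mul _))
          fun x => ?_
        change |x i| ≤ 1 / 2 + 1 / 2 * (x i * x i)
        nlinarith [sq_nonneg (|x i| - 1), abs_mul_abs_self (x i)]
    _ = 1 := by
        rw [integral_add (integrable_const _) (hi.const_mul _), integral_const_mul]
        simp only [integral_const, probReal_univ, integral_coord_mul_self]
        norm_num

lemma ouOp_coord (i : ι) (t : ℝ) (x : ι → ℝ) :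
    ouOp t (fun y => y i) x = Real.exp (-t) * x i := by
  have h0 : ∫ y : ι → ℝ, y i ∂gaussianPi ι = 0 :=
    integral_dual_gaussianPi (ContinuousLinearMap.proj (R := ℝ) (φ := fun _ : ι => ℝ) i)
  rw [ouOp, integral_add (integrable_const _) ((integrable_coord i).const_mul _),
    integral_const_mul (Real.sqrt _), h0]
  simp

lemma integral_coord_sub_mix_sq_le (i : ι) {s : ℝ} (hs : 0 ≤ s) :
    ∫ p, (p.1 i - mix s p.1 p.2 i) ^ 2 ∂(gaussianPi ι).prod (gaussianPi ι) ≤ 2 * s := by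
  have hm : Measurable fun x : ι → ℝ => x i := measurable_pi_apply i
  have h := integral_sub_mix_mul_sub_mix hs hm hm (memLp_coord i) (memLp_coord i)
  simp only [ouOp_coord, mul_left_comm _ (Real.exp _), integral_const_mul,
    integral_coord_mul_self] at h
  simp only [sq]
  rw [h]
  linarith [Real.add_one_le_exp (-s)]

end Coordinates

section ExistsRounding

variable {ι : Type*} {k : ℕ} {F : (ι → ℝ) → Fin k → ℝ}

lemma measurable_tilt (hF : ∀ i, BddMeas fun x => F x i) (i₀ : ι) (a : ℝ) (i : Fin k) :
    Measurable fun x => tilt F i₀ a x i :=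
  (hF i).measurable.add ((measurable_pi_apply i₀).const_mul _)

variable [Fintype ι]

lemma integrable_tilt (hF : ∀ i, BddMeas fun x => F x i) (i₀ : ι) (a : ℝ) (i : Fin k) :
    Integrable (fun x => tilt F i₀ a x i) (gaussianPi ι) :=
  ((hF i).integrable _).add ((integrable_coord i₀).const_mul _)

lemma abs_integral_tilt_sub_le (hF : ∀ i, BddMeas fun x => F x i) (i₀ : ι) {a : ℝ} (ha : 0 ≤ a)
    {g : (ι → ℝ) → Fin k} (hg : Measurable g) :
    |∫ x, tilt F i₀ a x (g x) ∂gaussianPi ι - ∫ x, F x (g x) ∂gaussianPi ι| ≤ a * k := by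
  rw [← integral_sub (integrable_apply_comp (integrable_tilt hF i₀ a) hg)
    (integrable_apply_comp (fun i => (hF i).integrable _) hg)]
  refine (abs_integral_le_integral_abs).trans ?_
  calc _ ≤ ∫ x : ι → ℝ, a * k * |x i₀| ∂gaussianPi ι := by
        refine integral_mono_of_nonneg (Filter.Eventually.of_forall fun _ => abs_nonneg _)
          ((integrable_coord i₀).abs.const_mul _) (Filter.Eventually.of_forall fun x => ?_)
        have hk : ((g x : ℕ) : ℝ) ≤ k := by exact_mod_cast (g x).2.le
        simp only [tilt, add_sub_cancel_left, abs_mul, abs_of_nonneg ha, Nat.abs_cast]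
        gcongr
    _ ≤ a * k := by
        rw [integral_const_mul]
        exact mul_le_of_le_one_right (by positivity) (integral_abs_coord_le_one i₀)

lemma measureReal_le_abs_tilt_sub_le (hF : ∀ i, BddMeas fun x => F x i) (i₀ : ι) {a s θ δ : ℝ}
    (ha : 0 ≤ a) (hs : 0 ≤ s) (hθ : 0 < θ) (i : Fin k)
    (hδ : ∫ p, (F p.1 i - F (mix s p.1 p.2) i) ^ 2 ∂(gaussianPi ι).prod (gaussianPi ι) ≤ δ) :
    ((gaussianPi ι).prod (gaussianPi ι)).real
      {p | θ ≤ |tilt F i₀ a p.1 i - tilt F i₀ a (mix s p.1 p.2) i|} ≤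
        (2 * δ + 4 * (a * k) ^ 2 * s) / θ ^ 2 := by
  set ν := (gaussianPi ι).prod (gaussianPi ι)
  have hX : MeasurePreserving (fun p : (ι → ℝ) × (ι → ℝ) => p.1) ν (gaussianPi ι) :=
    measurePreserving_fst
  have hY := measurePreserving_mix_exp (ι := ι) hs
  have hL : ∀ {g : (ι → ℝ) → ℝ}, MemLp g 2 (gaussianPi ι) →
      Integrable (fun p : (ι → ℝ) × (ι → ℝ) => (g p.1 - g (mix s p.1 p.2)) ^ 2) ν := fun hg =>
    ((hg.comp_measurePreserving hX).sub (hg.comp_measurePreserving hY)).integrable_sq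
  have i1 := hL ((hF i).memLp _)
  have i2 := hL (memLp_coord i₀)
  have i3 := hL (g := fun x => tilt F i₀ a x i)
    (((hF i).memLp _).add ((memLp_coord i₀).const_mul (a * i)))
  have hcheb := mul_meas_ge_le_integral_of_nonneg
    (Filter.Eventually.of_forall fun p => sq_nonneg _) i3 (θ ^ 2)
  have hset : {p : (ι → ℝ) × (ι → ℝ) | θ ≤ |tilt F i₀ a p.1 i - tilt F i₀ a (mix s p.1 p.2) i|} =
      {p | θ ^ 2 ≤ (tilt F i₀ a p.1 i - tilt F i₀ a (mix s p.1 p.2) i) ^ 2} := by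
    ext p
    simp only [Set.mem_ofPred_eq, sq_le_sq, abs_of_pos hθ]
  have hik : ((i : ℕ) : ℝ) ≤ k := by exact_mod_cast i.2.le
  have hle : ∫ p, (tilt F i₀ a p.1 i - tilt F i₀ a (mix s p.1 p.2) i) ^ 2 ∂ν ≤
      2 * δ + 2 * (a * k) ^ 2 * (2 * s) := by
    calc _ ≤ ∫ p, (2 * (F p.1 i - F (mix s p.1 p.2) i) ^ 2 +
          2 * (a * k) ^ 2 * (p.1 i₀ - mix s p.1 p.2 i₀) ^ 2) ∂ν := by
          refine integral_mono i3 ((i1.const_mul 2).add (i2.const_mul _)) fun p => ?_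
          have e : tilt F i₀ a p.1 i - tilt F i₀ a (mix s p.1 p.2) i =
              (F p.1 i - F (mix s p.1 p.2) i) + a * i * (p.1 i₀ - mix s p.1 p.2 i₀) := by
            simp only [tilt]; ring
          have h1 : (a * i) ^ 2 ≤ (a * k) ^ 2 := by gcongr
          have h2 := mul_le_mul_of_nonneg_right h1 (sq_nonneg (p.1 i₀ - mix s p.1 p.2 i₀))
          simp only [e]
          nlinarith [sq_nonneg ((F p.1 i - F (mix s p.1 p.2) i) -
            a * i * (p.1 i₀ - mix s p.1 p.2 i₀))]
      _ = 2 * ∫ p, (F p.1 i - F (mix s p.1 p.2) i) ^ 2 ∂ν +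
          2 * (a * k) ^ 2 * ∫ p, (p.1 i₀ - mix s p.1 p.2 i₀) ^ 2 ∂ν := by
          rw [integral_add (i1.const_mul 2) (i2.const_mul _), integral_const_mul,
            integral_const_mul]
      _ ≤ _ := by
          gcongr
          exact integral_coord_sub_mix_sq_le i₀ hs
  rw [hset, le_div_iff₀ (by positivity)]
  linarith

lemma gMean_eq (h : (ι → ℝ) → Fin k) (hh : Measurable h) (j : Fin k) :
    gMean h j = (gaussianPi ι).real {x | h x = j} := integral_basisVec_comp hh j

/-- Every bounded vector-valued function that varies slowly along the Ornstein–Uhlenbeck flow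
can be rounded to a noise stable partition with prescribed masses, at a small loss. -/
lemma exists_rounding (k : ℕ) [NeZero k] {ε : ℝ} (hε : 0 < ε) :
    ∃ δ > 0, ∃ s₀ > 0, ∀ (n : ℕ) (_ : Fin n) (F : (Fin n → ℝ) → Fin k → ℝ)
      (_ : ∀ i, BddMeas fun x => F x i) (f : (Fin n → ℝ) → Fin k) (_ : Measurable f),
      ∃ h : (Fin n → ℝ) → Fin k, Measurable h ∧ (∀ j, gMean h j = gMean f j) ∧
        ∫ x, F x (f x) ∂gaussianPi (Fin n) ≤ ∫ x, F x (h x) ∂gaussianPi (Fin n) + ε ∧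
        ∀ s, 0 ≤ s → s ≤ s₀ → (∀ i, ∫ p, (F p.1 i - F (mix s p.1 p.2) i) ^ 2
          ∂(gaussianPi (Fin n)).prod (gaussianPi (Fin n)) ≤ δ) → 1 - ε ≤ noiseStab s h := by
  have hK : (0 : ℝ) < k := by exact_mod_cast Nat.pos_of_ne_zero (NeZero.ne k)
  set K : ℝ := (k : ℝ) with hKdef
  set η := ε / (2 * K) with hη
  set b := ε / (2 * K ^ 2) with hb
  set r := b ^ 2 / (4 * K ^ 2) with hr
  set θ := b ^ 2 * η * r / (8 * K ^ 2) with hθ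
  have hη0 : 0 < η := by positivity
  have hb0 : 0 < b := by positivity
  have hr0 : 0 < r := by positivity
  have hθ0 : 0 < θ := by positivity
  refine ⟨ε * θ ^ 2 / (32 * K), by positivity, ε * θ ^ 2 / (64 * K * (η * K) ^ 2), by positivity,
    fun n i₀ F hF f hf => ?_⟩
  obtain ⟨a, ⟨ha0, ha1⟩, ha⟩ := exists_tilt (fun i => (hF i).measurable) i₀ hη0 hr0
    (show 0 ≤ 2 * θ by positivity)
  have hbeq : K * K * (2 * r + 2 * (2 * θ) / (η * r)) = b ^ 2 := by
    have h1 : 2 * (2 * θ) / (η * r) = b ^ 2 / (2 * K ^ 2) := by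
      rw [hθ]; field_simp; ring
    rw [h1, hr]; field_simp; ring
  have hanti : ∀ i j, i ≠ j → ∀ w : ℝ, (gaussianPi (Fin n)).real
      {x | |tilt F i₀ a x i - tilt F i₀ a x j - w| ≤ θ} ≤ b := fun i j hij w => by
    have h1 := (measure_abs_sub_le_sq_le (μ := gaussianPi (Fin n))
      (fun x => tilt F i₀ a x i - tilt F i₀ a x j) w θ).trans (ha i j hij).1
    rw [hbeq, ENNReal.ofReal_pow hb0.le] at h1
    exact ENNReal.toReal_le_of_le_ofReal hb0.le ((ENNReal.pow_le_pow_left_iff two_ne_zero).1 h1)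
  have hties : ∀ i j, i ≠ j → ∀ w : ℝ, gaussianPi (Fin n)
      {x | tilt F i₀ a x i - tilt F i₀ a x j = w} = 0 := fun i j hij w => by
    have h1 := measure_abs_sub_le_sq_le (μ := gaussianPi (Fin n))
      (fun x => tilt F i₀ a x i - tilt F i₀ a x j) w 0
    rw [mul_zero, (ha i j hij).2] at h1
    have h2 := pow_eq_zero_iff two_ne_zero |>.1 (le_antisymm h1 bot_le)
    simpa only [abs_nonpos_iff, sub_eq_zero] using h2
  have hm1 : ∑ j, (gaussianPi (Fin n)).real {x | f x = j} = 1 := by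
    have := integral_const_comp (μ := gaussianPi (Fin n)) hf fun _ => 1
    simpa using this.symm
  obtain ⟨z, h, hh, hmax, hpos, hmass⟩ := exists_partition
    (m := fun j => (gaussianPi (Fin n)).real {x | f x = j}) (measurable_tilt hF i₀ a)
    (integrable_tilt hF i₀ a) (fun _ => measureReal_nonneg) hm1 hties
  refine ⟨h, hh, fun j => by rw [gMean_eq h hh, gMean_eq f hf, hmass], ?_, fun s hs hs0 hδ => ?_⟩
  · have h1 := integral_apply_comp_le (integrable_tilt hF i₀ a) hf hh
      (fun _ => measureReal_nonneg) hmax (fun _ => rfl) hmass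
    have h2 := abs_le.1 (abs_integral_tilt_sub_le hF i₀ ha0 hf)
    have h3 := abs_le.1 (abs_integral_tilt_sub_le hF i₀ ha0 hh)
    have h4 : a * K ≤ ε / 2 := by
      calc a * K ≤ η * K := by gcongr
        _ = ε / 2 := by rw [hη]; field_simp
    linarith [h2.1, h3.2]
  · have h1 := measureReal_ne_le (X := fun p => p.1) (Y := fun p => mix s p.1 p.2)
      (ν := (gaussianPi (Fin n)).prod (gaussianPi (Fin n))) measurePreserving_fst
      (measurable_tilt hF i₀ a) hmax hpos θ hanti hb0.le
    rw [← one_sub_noiseStab_eq hh] at h1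
    have h2 : ∀ i, ((gaussianPi (Fin n)).prod (gaussianPi (Fin n))).real
        {p | θ / 2 ≤ |tilt F i₀ a p.1 i - tilt F i₀ a (mix s p.1 p.2) i|} ≤ ε / (2 * K) :=
      fun i => by
        refine (measureReal_le_abs_tilt_sub_le hF i₀ ha0 hs (half_pos hθ0) i (hδ i)).trans ?_
        rw [div_le_iff₀ (by positivity)]
        have h3 : 4 * (a * K) ^ 2 * s ≤ 4 * (η * K) ^ 2 * (ε * θ ^ 2 / (64 * K * (η * K) ^ 2)) := by
          gcongr
        refine (add_le_add_right h3 _).trans (le_of_eq ?_)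
        field_simp
        ring
    have h3 := Finset.sum_le_sum fun i (_ : i ∈ Finset.univ) => h2 i
    have h4 : ∑ _i : Fin k, ε / (2 * K) = ε / 2 := by
      simp only [Finset.sum_const, Finset.card_univ, Fintype.card_fin, nsmul_eq_mul, ← hKdef]
      field_simp
    have h5 : K * K * b = ε / 2 := by rw [hb]; field_simp
    linarith

end ExistsRounding

section Smoothing

variable {ι : Type*} [Fintype ι] {k : ℕ}

lemma integral_ouOp_basisVec_self (f : (ι → ℝ) → Fin k) (t : ℝ) :
    ∫ x, ouOp t (fun y => basisVec (f y) (f x)) x ∂gaussianPi ι = noiseStab t f := by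
  simp only [noiseStab, sum_basisVec_mul]

lemma two_mul_integral_ouOp_sub_noiseStab_le {f h : (ι → ℝ) → Fin k} (hf : Measurable f)
    (hh : Measurable h) {t : ℝ} (ht : 0 ≤ t) :
    2 * ∫ x, ouOp t (fun y => basisVec (f y) (h x)) x ∂gaussianPi ι - noiseStab t f ≤
      noiseStab t h := by
  have h1 : ∫ x, ouOp t (fun y => basisVec (f y) (h x)) x ∂gaussianPi ι =
      ∑ j, ∫ x, basisVec (h x) j * ouOp t (fun y => basisVec (f y) j) x ∂gaussianPi ι := by
    rw [← integral_finsetSum _ fun j _ => ((bddMeas_basisVec_comp hh j).mul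
      ((bddMeas_basisVec_comp hf j).ouOp t)).integrable _]
    simp only [sum_basisVec_mul]
  rw [h1, noiseStab_eq_sum hf, noiseStab_eq_sum hh, Finset.mul_sum, ← Finset.sum_sub_distrib]
  exact Finset.sum_le_sum fun j _ =>
    two_mul_integral_ouOp_le (bddMeas_basisVec_comp hf j) (bddMeas_basisVec_comp hh j) ht

lemma wAbove_of_isEmpty [IsEmpty ι] (d : ℕ) (f : (ι → ℝ) → Fin k → ℝ) : wAbove d f = 0 := by
  simp [wAbove]

end Smoothing

/-- For every `k`, `ε > 0` there is `d = d(k, ε)` such that for every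
`n`, `t > 0` and measurable `f : ℝⁿ → [k]` there is measurable `h : ℝⁿ → [k]` with
`E[h] = E[f]`, `E⟨h, P_t h⟩ ≥ E⟨f, P_t f⟩ - ε`, and `W^{> d}[h] ≤ ε`. -/
theorem stmt3 (k : ℕ) [NeZero k] (ε : ℝ) (hε : 0 < ε) :
    ∃ d : ℕ, ∀ (n : ℕ) (t : ℝ), 0 < t → ∀ f : (Fin n → ℝ) → Fin k, Measurable f →
      ∃ h : (Fin n → ℝ) → Fin k, Measurable h ∧
        (∀ j, gMean h j = gMean f j) ∧
        noiseStab t h ≥ noiseStab t f - ε ∧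
        wAbove d (fun x => basisVec (h x)) ≤ ε := by
  obtain ⟨δ, hδ, s₀, hs₀, H⟩ := exists_rounding k (half_pos hε)
  obtain ⟨N, hN⟩ := exists_nat_ge (max 2 (2 / δ))
  have hN2 : (2 : ℝ) ≤ N := (le_max_left _ _).trans hN
  have hN0 : (0 : ℝ) < N := two_pos.trans_le hN2
  have hNδ : 2 / (N : ℝ) ≤ δ := (div_le_comm₀ hN0 hδ).2 ((le_max_right _ _).trans hN)
  obtain ⟨s, hsdef⟩ : ∃ s, s = 2 * s₀ / (N : ℝ) := ⟨_, rfl⟩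
  have hs : 0 < s := by rw [hsdef]; positivity
  have hNs : N * s = 2 * s₀ := by rw [hsdef]; field_simp
  have hss₀ : s ≤ s₀ := by rw [hsdef, div_le_iff₀ hN0]; nlinarith
  obtain ⟨d, hd⟩ := exists_pow_lt_of_lt_one (show (0 : ℝ) < 1 / 2 by norm_num)
    (Real.exp_lt_one_iff.2 (neg_lt_zero.2 hs))
  have hd' : Real.exp (-s) ^ (d + 1) ≤ 1 / 2 :=
    (pow_le_pow_of_le_one (Real.exp_nonneg _) (Real.exp_le_one_iff.2 (neg_nonpos.2 hs.le))
      d.le_succ).trans hd.le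
  refine ⟨d, fun n t ht f hf => ?_⟩
  rcases isEmpty_or_nonempty (Fin n) with hn | ⟨⟨i₀⟩⟩
  · exact ⟨f, hf, fun _ => rfl, by linarith, by rw [wAbove_of_isEmpty]; exact hε.le⟩
  rcases le_or_gt s₀ t with hts | hts
  · obtain ⟨h, hh, hmean, hle, hst⟩ := H n i₀ (fun x j => ouOp t (fun y => basisVec (f y) j) x)
      (fun j => (bddMeas_basisVec_comp hf j).ouOp t) f hf
    have h1 := hst s hs.le hss₀ fun j => (integral_ouOp_sub_mix_sq_le
      (measurable_basisVec_comp hf j) (fun x => abs_basisVec_le_one _ _) hs.le N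
      (by exact_mod_cast hN0) (by linarith)).trans hNδ
    refine ⟨h, hh, hmean, ?_, (wAbove_le hh hs.le hd').trans (by linarith)⟩
    have h2 := two_mul_integral_ouOp_sub_noiseStab_le hf hh ht.le
    rw [integral_ouOp_basisVec_self f] at hle
    linarith
  · obtain ⟨h, hh, hmean, -, hst⟩ := H n i₀ (fun _ _ => 0) (fun _ => ⟨measurable_const, 0, by simp⟩)
      f hf
    have h1 := fun r (hr : 0 ≤ r) hr' => hst r hr hr' (by simpa using hδ.le)
    refine ⟨h, hh, hmean, ?_, (wAbove_le hh hs.le hd').trans (by linarith [h1 s hs.le hss₀])⟩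
    linarith [h1 t ht.le hts.le, noiseStab_le_one hf t]
end
end

section
/- Let h: ℝⁿ → [k] be measurable with W^{>d}[h] ≤ ε. Then there is a degree-d multivariate PTF g: ℝⁿ → [k] such that Pr[g(x) ≠ h(x)] ≤ k²·ε and Pr[x ∈ Collision(g)] ≤ k²·ε. -/
open MeasureTheory ProbabilityTheory MvPolynomial
open scoped Classical

noncomputable section

namespace GaussNS

lemma integrable_polynomial_eval_gaussianReal (q : Polynomial ℝ) :
    Integrable (fun x => q.eval x) (gaussianReal 0 1) := by
  simp_rw [Polynomial.eval_eq_sum_range]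
  refine integrable_finsetSum _ fun i _ => Integrable.const_mul ?_ _
  exact integrable_pow_of_mem_interior_integrableExpSet (X := fun x => x) (by simp) i

lemma integrable_gaussianReal_iff (f : ℝ → ℝ) :
    Integrable f (gaussianReal 0 1) ↔ Integrable (fun x => gaussianPDFReal 0 1 x * f x) := by
  rw [gaussianReal_of_var_ne_zero _ one_ne_zero,
    integrable_withDensity_iff_integrable_smul' (measurable_gaussianPDF 0 1)
      (ae_of_all _ fun _ => gaussianPDF_lt_top)]
  simp

lemma hasDerivAt_gaussianPDFReal_zero_one (x : ℝ) :
    HasDerivAt (gaussianPDFReal 0 1) (-x * gaussianPDFReal 0 1 x) x := by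
  have h : HasDerivAt (fun x : ℝ => -(x - 0) ^ 2 / (2 * ((1 : NNReal) : ℝ))) (-x) x := by
    have := ((((hasDerivAt_id x).sub_const 0).pow 2).neg).div_const (2 * ((1 : NNReal) : ℝ))
    refine this.congr_deriv ?_
    simp
    ring
  rw [gaussianPDFReal_def]
  refine (h.exp.const_mul _).congr_deriv ?_
  ring

/-- Gaussian integration by parts for polynomials. -/
lemma integral_X_mul_gaussianReal (q : Polynomial ℝ) :
    ∫ x, (Polynomial.X * q).eval x ∂gaussianReal 0 1 =
      ∫ x, (Polynomial.derivative q).eval x ∂gaussianReal 0 1 := by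
  rw [← sub_eq_zero, ← integral_sub (integrable_polynomial_eval_gaussianReal _)
    (integrable_polynomial_eval_gaussianReal _),
    integral_gaussianReal_eq_integral_smul one_ne_zero, ← neg_eq_zero, ← integral_neg]
  have integrable_mul_pdf (r : Polynomial ℝ) : Integrable fun x => gaussianPDFReal 0 1 x * r.eval x :=
    (integrable_gaussianReal_iff _).1 (integrable_polynomial_eval_gaussianReal r)
  refine integral_eq_zero_of_hasDerivAt_of_integrable
    (f := fun x => gaussianPDFReal 0 1 x * q.eval x) (fun x => ?_) ?_ (integrable_mul_pdf q)
  · refine ((hasDerivAt_gaussianPDFReal_zero_one x).mul (q.hasDerivAt x)).congr_deriv ?_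
    simp
    ring
  · convert! integrable_mul_pdf (Polynomial.derivative q - Polynomial.X * q) using 2
    simp
    ring

/-- The probabilists' Hermite polynomial with real coefficients. -/
def realHermite (m : ℕ) : Polynomial ℝ := (Polynomial.hermite m).map (Int.castRingHom ℝ)

lemma realHermite_monic (m : ℕ) : (realHermite m).Monic :=
  (Polynomial.hermite_monic m).map _

lemma natDegree_realHermite (m : ℕ) : (realHermite m).natDegree = m := by
  rw [realHermite, (Polynomial.hermite_monic m).natDegree_map, Polynomial.natDegree_hermite]

lemma aeval_hermite_eq (m : ℕ) (x : ℝ) :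
    Polynomial.aeval x (Polynomial.hermite m) = (realHermite m).eval x := by
  rw [realHermite, Polynomial.eval_map, Polynomial.aeval_def]
  rfl

lemma realHermite_succ (m : ℕ) : realHermite (m + 1) =
    Polynomial.X * realHermite m - Polynomial.derivative (realHermite m) := by
  simp [realHermite, Polynomial.hermite_succ, Polynomial.derivative_map]

lemma integral_realHermite_mul (m : ℕ) (q : Polynomial ℝ) :
    ∫ x, (realHermite m * q).eval x ∂gaussianReal 0 1 =
      ∫ x, (Polynomial.derivative^[m] q).eval x ∂gaussianReal 0 1 := by
  induction m generalizing q with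
  | zero => simp [realHermite]
  | succ m ih =>
    have h : realHermite (m + 1) * q = Polynomial.X * (realHermite m * q)
        - Polynomial.derivative (realHermite m * q)
        + realHermite m * Polynomial.derivative q := by
      rw [realHermite_succ, Polynomial.derivative_mul]
      ring
    simp_rw [h, Polynomial.eval_add]
    rw [integral_add (integrable_polynomial_eval_gaussianReal _)
      (integrable_polynomial_eval_gaussianReal _)]
    simp_rw [Polynomial.eval_sub]
    rw [integral_sub (integrable_polynomial_eval_gaussianReal _)
      (integrable_polynomial_eval_gaussianReal _), integral_X_mul_gaussianReal, ih,
      sub_self, zero_add, Function.iterate_succ_apply]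

lemma integral_realHermite_mul_realHermite (a b : ℕ) :
    ∫ x, (realHermite a).eval x * (realHermite b).eval x ∂gaussianReal 0 1 =
      if a = b then (a.factorial : ℝ) else 0 := by
  have hlt {a b : ℕ} (hab : b < a) :
      ∫ x, (realHermite a).eval x * (realHermite b).eval x ∂gaussianReal 0 1 = 0 := by
    simp_rw [← Polynomial.eval_mul]
    rw [integral_realHermite_mul, Polynomial.iterate_derivative_eq_zero
      (by rwa [natDegree_realHermite])]
    simp
  rcases lt_trichotomy a b with hab | rfl | hab
  · simp_rw [mul_comm (Polynomial.eval _ (realHermite a))]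
    rw [hlt hab, if_neg hab.ne]
  · simp_rw [← Polynomial.eval_mul]
    have hd : (Polynomial.derivative^[a] (realHermite a)).natDegree = 0 := by
      have := Polynomial.natDegree_iterate_derivative (realHermite a) a
      rw [natDegree_realHermite] at this
      omega
    rw [integral_realHermite_mul, Polynomial.eq_C_of_natDegree_eq_zero hd,
      Polynomial.coeff_iterate_derivative]
    have hc := realHermite_monic a
    rw [Polynomial.Monic, Polynomial.leadingCoeff, natDegree_realHermite] at hc
    simp [hc, Nat.descFactorial_self]
  · rw [hlt hab, if_neg hab.ne']

/-- The normalized univariate Hermite polynomial `H_a / √(a!)`. -/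
def normHermite (a : ℕ) : Polynomial ℝ :=
  Polynomial.C (Real.sqrt a.factorial)⁻¹ * realHermite a

lemma integral_normHermite_mul_normHermite (a b : ℕ) :
    ∫ x, (normHermite a).eval x * (normHermite b).eval x ∂gaussianReal 0 1 =
      if a = b then 1 else 0 := by
  have h (x : ℝ) : (normHermite a).eval x * (normHermite b).eval x =
      ((Real.sqrt a.factorial)⁻¹ * (Real.sqrt b.factorial)⁻¹) *
        ((realHermite a).eval x * (realHermite b).eval x) := by
    simp [normHermite]
    ring
  simp_rw [h]
  rw [integral_const_mul, integral_realHermite_mul_realHermite]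
  split_ifs with hab
  · subst hab
    rw [← mul_inv, Real.mul_self_sqrt (by positivity), inv_mul_cancel₀ (by positivity)]
  · simp

lemma natDegree_normHermite_le (a : ℕ) : (normHermite a).natDegree ≤ a :=
  (Polynomial.natDegree_C_mul_le _ _).trans (natDegree_realHermite a).le

/-- The normalized Hermite polynomials, as a sequence with one polynomial in each degree. -/
def normHermiteSequence : Polynomial.Sequence ℝ where
  elems' := normHermite
  degree_eq' a := by
    have h : (Real.sqrt a.factorial)⁻¹ ≠ 0 := by positivity
    rw [normHermite, Polynomial.degree_C_mul h,
      Polynomial.degree_eq_natDegree (realHermite_monic a).ne_zero, natDegree_realHermite]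

lemma exists_eq_sum_normHermite (q : Polynomial ℝ) :
    ∃ (s : Finset ℕ) (c : ℕ → ℝ), q = ∑ b ∈ s, c b • normHermite b := by
  have h : q ∈ Submodule.span ℝ (Set.range normHermite) := by
    have := normHermiteSequence.span fun i => by
      rw [isUnit_iff_ne_zero, Polynomial.leadingCoeff_ne_zero]
      exact normHermiteSequence.ne_zero i
    exact this ▸ Submodule.mem_top
  obtain ⟨c, rfl⟩ := (Finsupp.mem_span_range_iff_exists_finsupp).1 h
  exact ⟨c.support, c, rfl⟩

variable {ι : Type*} [Fintype ι]

instance : IsProbabilityMeasure (gaussianPi ι) := by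
  unfold gaussianPi
  infer_instance

lemma hermiteH_eq_prod (S : ι → ℕ) (x : ι → ℝ) :
    hermiteH S x = ∏ i, (normHermite (S i)).eval (x i) := by
  refine Finset.prod_congr rfl fun i _ => ?_
  rw [aeval_hermite_eq, normHermite, Polynomial.eval_C_mul, div_eq_inv_mul]

lemma integrable_hermiteH_mul_hermiteH (S T : ι → ℕ) :
    Integrable (fun x => hermiteH S x * hermiteH T x) (gaussianPi ι) := by
  simp_rw [hermiteH_eq_prod, ← Finset.prod_mul_distrib, ← Polynomial.eval_mul]
  exact Integrable.fintype_prod (f := fun i x => (normHermite (S i) * normHermite (T i)).eval x)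
    fun i => integrable_polynomial_eval_gaussianReal _

lemma integral_hermiteH_mul_hermiteH (S T : ι → ℕ) :
    ∫ x, hermiteH S x * hermiteH T x ∂gaussianPi ι = if S = T then 1 else 0 := by
  simp_rw [hermiteH_eq_prod, ← Finset.prod_mul_distrib]
  rw [gaussianPi, integral_fintype_prod_eq_prod
    (fun i x => (normHermite (S i)).eval x * (normHermite (T i)).eval x)]
  simp_rw [integral_normHermite_mul_normHermite, Finset.prod_ite_zero, Finset.prod_const_one,
    funext_iff, Finset.mem_univ, true_imp_iff]

@[fun_prop]
lemma continuous_hermiteH (S : ι → ℕ) : Continuous (hermiteH (ι := ι) S) := by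
  simp_rw [funext (hermiteH_eq_prod S)]
  fun_prop

lemma memLp_hermiteH (S : ι → ℕ) : MemLp (hermiteH S) 2 (gaussianPi ι) := by
  rw [memLp_two_iff_integrable_sq (continuous_hermiteH S).aestronglyMeasurable]
  simpa only [sq] using integrable_hermiteH_mul_hermiteH S S

/-- The normalized multivariate Hermite polynomial as an `MvPolynomial`. -/
def mvHermite (S : ι → ℕ) : MvPolynomial ι ℝ := ∏ i, Polynomial.aeval (X i) (normHermite (S i))

lemma eval_mvHermite (S : ι → ℕ) (x : ι → ℝ) : eval x (mvHermite S) = hermiteH S x := by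
  simp only [hermiteH_eq_prod, mvHermite, map_prod]
  refine Finset.prod_congr rfl fun i _ => ?_
  have := Polynomial.aeval_algHom_apply (MvPolynomial.aeval x) (X i) (normHermite (S i))
  simp only [MvPolynomial.aeval_X, Polynomial.coe_aeval_eq_eval] at this
  exact this.symm

lemma totalDegree_aeval_X_le {σ R : Type*} [CommSemiring R] [Nontrivial R] (i : σ) (q : Polynomial R) :
    (Polynomial.aeval (X i : MvPolynomial σ R) q).totalDegree ≤ q.natDegree := by
  rw [Polynomial.aeval_eq_sum_range]
  refine totalDegree_finsetSum_le fun a ha => ?_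
  refine (totalDegree_smul_le _ _).trans ((totalDegree_pow _ _).trans ?_)
  rw [totalDegree_X, mul_one]
  exact Nat.lt_succ_iff.1 (Finset.mem_range.1 ha)

lemma totalDegree_mvHermite_le (S : ι → ℕ) : (mvHermite S).totalDegree ≤ ∑ i, S i :=
  (totalDegree_finsetProd _ _).trans <| Finset.sum_le_sum fun i _ =>
    (totalDegree_aeval_X_le i _).trans (natDegree_normHermite_le _)

lemma dual_apply_eq_sum (L : StrongDual ℝ (ι → ℝ)) (x : ι → ℝ) :
    L x = ∑ i, L (Pi.single i 1) * x i := by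
  conv_lhs => rw [← Finset.univ_sum_single x, map_sum]
  refine Finset.sum_congr rfl fun i _ => ?_
  have : (Pi.single i (x i) : ι → ℝ) = x i • Pi.single i 1 := by
    rw [← Pi.single_smul, smul_eq_mul, mul_one]
  rw [this, map_smul, smul_eq_mul, mul_comm]

lemma integrable_exp_mul_dual_gaussianPi (L : StrongDual ℝ (ι → ℝ)) (t : ℝ) :
    Integrable (fun x => Real.exp (t * L x)) (gaussianPi ι) := by
  have h (x : ι → ℝ) : Real.exp (t * L x) =
      ∏ i, Real.exp (t * L (Pi.single i 1) * x i) := by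
    rw [← Real.exp_sum]
    simp_rw [dual_apply_eq_sum L x, Finset.mul_sum, mul_assoc]
  simp_rw [h]
  exact Integrable.fintype_prod (f := fun i x => Real.exp (t * L (Pi.single i 1) * x))
    fun i => integrable_exp_mul_gaussianReal _

lemma memLp_exp_mul_dual_gaussianPi (L : StrongDual ℝ (ι → ℝ)) (t : ℝ) :
    MemLp (fun x => Real.exp (t * L x)) 2 (gaussianPi ι) := by
  rw [memLp_two_iff_integrable_sq (by fun_prop)]
  convert! integrable_exp_mul_dual_gaussianPi L (2 * t) using 2 with x
  rw [← Real.exp_nat_mul]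
  congr 1
  push_cast
  ring

lemma exists_eval_mvPolynomial_eq_sum_hermiteH (q : MvPolynomial ι ℝ) :
    ∃ (s : Finset (ι → ℕ)) (c : (ι → ℕ) → ℝ),
      ∀ x, eval x q = ∑ S ∈ s, c S * hermiteH S x := by
  have hspan : (fun x => eval x q) ∈ Submodule.span ℝ (Set.range (hermiteH (ι := ι))) := by
    simp_rw [eval_eq']
    rw [show (fun x : ι → ℝ => ∑ m ∈ q.support, coeff m q * ∏ i, x i ^ m i) =
      ∑ m ∈ q.support, coeff m q • fun x : ι → ℝ => ∏ i, x i ^ m i by ext; simp]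
    refine Submodule.sum_mem _ fun m _ => Submodule.smul_mem _ _ ?_
    choose s c hsc using fun a : ℕ => exists_eq_sum_normHermite (Polynomial.X ^ a)
    have h (x : ι → ℝ) : ∏ i, x i ^ m i =
        ∑ S ∈ Fintype.piFinset fun i => s (m i), (∏ i, c (m i) (S i)) * hermiteH S x := by
      have hx (a : ℕ) (y : ℝ) : y ^ a = ∑ b ∈ s a, c a b * (normHermite b).eval y := by
        conv_lhs => rw [← Polynomial.eval_X (x := y), ← Polynomial.eval_pow, hsc a]
        simp [Polynomial.eval_finsetSum]
      simp_rw [hx, Finset.prod_univ_sum, Finset.prod_mul_distrib, hermiteH_eq_prod]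
    rw [show (fun x : ι → ℝ => ∏ i, x i ^ m i) = ∑ S ∈ Fintype.piFinset fun i => s (m i),
      (∏ i, c (m i) (S i)) • hermiteH S by ext; simp [h]]
    exact Submodule.sum_mem _ fun S _ => Submodule.smul_mem _ _ (Submodule.subset_span ⟨S, rfl⟩)
  obtain ⟨c, hc⟩ := (Finsupp.mem_span_range_iff_exists_finsupp).1 hspan
  refine ⟨c.support, c, fun x => ?_⟩
  rw [← congrFun hc x]
  simp [Finsupp.sum]

lemma integrable_mul_hermiteH {g : (ι → ℝ) → ℝ} (hg : MemLp g 2 (gaussianPi ι)) (S : ι → ℕ) :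
    Integrable (fun x => g x * hermiteH S x) (gaussianPi ι) :=
  hg.integrable_mul (memLp_hermiteH S)

lemma integral_mul_eval_eq_zero {g : (ι → ℝ) → ℝ} (hg : MemLp g 2 (gaussianPi ι))
    (h0 : ∀ S, hermCoeff g S = 0) (q : MvPolynomial ι ℝ) :
    ∫ x, g x * eval x q ∂gaussianPi ι = 0 := by
  obtain ⟨s, c, hc⟩ := exists_eval_mvPolynomial_eq_sum_hermiteH q
  simp_rw [hc, Finset.mul_sum, mul_left_comm (g _)]
  rw [integral_finsetSum _ fun S _ => (integrable_mul_hermiteH hg S).const_mul _]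
  refine Finset.sum_eq_zero fun S _ => ?_
  rw [integral_const_mul]
  exact mul_eq_zero_of_right _ (h0 S)

/-- Finite exponential moments of all orders make the moment problem determinate. -/
lemma map_eq_of_integral_pow_eq {Ω : Type*} [MeasurableSpace Ω] {X : Ω → ℝ} {μ ν : Measure Ω}
    [IsFiniteMeasure μ] [IsFiniteMeasure ν] (hXμ : AEMeasurable X μ) (hXν : AEMeasurable X ν)
    (hμ : integrableExpSet X μ = Set.univ) (hν : integrableExpSet X ν = Set.univ)
    (h : ∀ m : ℕ, ∫ ω, X ω ^ m ∂μ = ∫ ω, X ω ^ m ∂ν) : μ.map X = ν.map X := by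
  have hmgf : mgf X μ = mgf X ν := by
    have hanμ : AnalyticOnNhd ℝ (mgf X μ) Set.univ := by
      simpa [hμ] using analyticOnNhd_mgf (X := X) (μ := μ)
    have hanν : AnalyticOnNhd ℝ (mgf X ν) Set.univ := by
      simpa [hν] using analyticOnNhd_mgf (X := X) (μ := ν)
    refine hanμ.eq_of_eventuallyEq hanν (z₀ := 0) ?_
    have hpμ := hasFPowerSeriesAt_mgf (X := X) (μ := μ) (v := 0) (by simp [hμ])
    have hpν := hasFPowerSeriesAt_mgf (X := X) (μ := ν) (v := 0) (by simp [hν])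
    simp only [zero_mul, Real.exp_zero, mul_one] at hpμ hpν
    simp_rw [h] at hpμ
    filter_upwards [hpμ.eventually_hasSum_sub, hpν.eventually_hasSum_sub] with y h1 h2
    exact h1.unique h2
  have hzero : μ = 0 ↔ ν = 0 := by
    have := h 0
    simp only [pow_zero, integral_const, smul_eq_mul, mul_one] at this
    rw [← Measure.measure_univ_eq_zero, ← Measure.measure_univ_eq_zero,
      ← measureReal_eq_zero_iff, ← measureReal_eq_zero_iff, this]
  refine Measure.ext_of_complexMGF_eq hXμ hXν (funext fun z => ?_)
  exact eqOn_complexMGF_of_mgf' hmgf hzero (by simp [hμ])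

lemma integrable_withDensity_ofReal {Ω : Type*} [MeasurableSpace Ω] {μ : Measure Ω}
    {g f : Ω → ℝ} (hg : AEMeasurable g μ) (hf : AEStronglyMeasurable f μ)
    (hgf : Integrable (fun x => g x * f x) μ) :
    Integrable f (μ.withDensity fun x => ENNReal.ofReal (g x)) := by
  rw [integrable_withDensity_iff_integrable_smul₀' hg.ennreal_ofReal
    (ae_of_all _ fun _ => ENNReal.ofReal_lt_top)]
  refine hgf.mono (hg.ennreal_ofReal.ennreal_toReal.aestronglyMeasurable.smul hf)
    (ae_of_all _ fun x => ?_)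
  rw [norm_smul, norm_mul, ENNReal.toReal_ofReal', Real.norm_eq_abs, Real.norm_eq_abs (g x)]
  refine mul_le_mul_of_nonneg_right ?_ (norm_nonneg _)
  rw [abs_of_nonneg (le_max_right _ _)]
  exact max_le (le_abs_self _) (abs_nonneg _)

lemma integral_withDensity_ofReal_sub {Ω : Type*} [MeasurableSpace Ω] {μ : Measure Ω}
    {g f : Ω → ℝ} (hg : AEMeasurable g μ) (hf : AEStronglyMeasurable f μ)
    (hgf : Integrable (fun x => g x * f x) μ) :
    ∫ x, f x ∂(μ.withDensity fun x => ENNReal.ofReal (g x)) -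
      ∫ x, f x ∂(μ.withDensity fun x => ENNReal.ofReal (-g x)) = ∫ x, g x * f x ∂μ := by
  have hng : AEMeasurable (fun x => -g x) μ := hg.neg
  have h1 := integrable_withDensity_ofReal hg hf hgf
  have h2 := integrable_withDensity_ofReal hng hf (by simpa using hgf.neg)
  rw [integrable_withDensity_iff_integrable_smul₀' hg.ennreal_ofReal
    (ae_of_all _ fun _ => ENNReal.ofReal_lt_top)] at h1
  rw [integrable_withDensity_iff_integrable_smul₀' hng.ennreal_ofReal
    (ae_of_all _ fun _ => ENNReal.ofReal_lt_top)] at h2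
  rw [integral_withDensity_eq_integral_toReal_smul₀ hg.ennreal_ofReal
      (ae_of_all _ fun _ => ENNReal.ofReal_lt_top),
    integral_withDensity_eq_integral_toReal_smul₀ hng.ennreal_ofReal
      (ae_of_all _ fun _ => ENNReal.ofReal_lt_top), ← integral_sub h1 h2]
  congr with x
  rw [← sub_smul, smul_eq_mul, ENNReal.toReal_ofReal', ENNReal.toReal_ofReal']
  congr 1
  rcases le_total (g x) 0 with hx | hx <;> simp [hx]

/-- Completeness of the Hermite system in `L²(γ)`. -/
theorem ae_eq_zero_of_hermCoeff_eq_zero {g : (ι → ℝ) → ℝ} (hg : MemLp g 2 (gaussianPi ι))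
    (h0 : ∀ S, hermCoeff g S = 0) : g =ᵐ[gaussianPi ι] 0 := by
  have hgm := hg.aestronglyMeasurable.aemeasurable
  have hgi : Integrable g (gaussianPi ι) := hg.integrable one_le_two
  set μ := (gaussianPi ι).withDensity fun x => ENNReal.ofReal (g x) with hμ
  set ν := (gaussianPi ι).withDensity fun x => ENNReal.ofReal (-g x) with hν
  have : IsFiniteMeasure μ := isFiniteMeasure_withDensity_ofReal hgi.2
  have : IsFiniteMeasure ν := isFiniteMeasure_withDensity_ofReal hgi.neg.2
  have hmap (L : StrongDual ℝ (ι → ℝ)) : μ.map L = ν.map L := by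
    have hexp (t : ℝ) : Integrable (fun x => g x * Real.exp (t * L x)) (gaussianPi ι) :=
      hg.integrable_mul (memLp_exp_mul_dual_gaussianPi L t)
    have hμe : integrableExpSet L μ = Set.univ := Set.eq_univ_of_forall fun t =>
      integrable_withDensity_ofReal hgm (by fun_prop) (hexp t)
    have hνe : integrableExpSet L ν = Set.univ := Set.eq_univ_of_forall fun t =>
      integrable_withDensity_ofReal hgm.neg (by fun_prop) (by simpa using (hexp t).neg)
    refine map_eq_of_integral_pow_eq (by fun_prop) (by fun_prop) hμe hνe fun m => ?_
    have hL (x : ι → ℝ) :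
        L x ^ m = eval x ((∑ i, C (L (Pi.single i 1)) * X i) ^ m) := by
      simp only [map_pow, map_sum, map_mul, eval_C, eval_X, dual_apply_eq_sum L x]
    obtain ⟨s, c, hc⟩ := exists_eval_mvPolynomial_eq_sum_hermiteH
      ((∑ i, C (L (Pi.single i 1)) * X i) ^ m)
    rw [← sub_eq_zero, hμ, hν, integral_withDensity_ofReal_sub hgm (by fun_prop)]
    · simp_rw [hL]
      exact integral_mul_eval_eq_zero hg h0 _
    · simp_rw [hL, hc, Finset.mul_sum, mul_left_comm (g _)]
      exact integrable_finsetSum _ fun S _ => (integrable_mul_hermiteH hg S).const_mul _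
  have hμν : μ = ν := Measure.ext_of_charFunDual <| funext fun L => by
    rw [charFunDual_eq_charFun_map_one, charFunDual_eq_charFun_map_one, hmap]
  have hae := (withDensity_eq_iff hgm.ennreal_ofReal hgm.neg.ennreal_ofReal
    hgi.lintegral_lt_top.ne).1 hμν
  filter_upwards [hae] with x hx
  have := congrArg ENNReal.toReal hx
  rw [ENNReal.toReal_ofReal', ENNReal.toReal_ofReal'] at this
  rcases le_total (g x) 0 with h | h <;> simp_all

lemma inner_toLp_toLp {f g : (ι → ℝ) → ℝ} (hf : MemLp f 2 (gaussianPi ι))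
    (hg : MemLp g 2 (gaussianPi ι)) :
    inner ℝ (hf.toLp f) (hg.toLp g) = ∫ x, f x * g x ∂gaussianPi ι := by
  rw [L2.inner_def]
  refine integral_congr_ae ?_
  filter_upwards [hf.coeFn_toLp, hg.coeFn_toLp] with x hx hy
  rw [hx, hy]
  simp [mul_comm]

/-- The Hermite polynomials as elements of `L²(γ)`. -/
def hermiteLp (S : ι → ℕ) : Lp ℝ 2 (gaussianPi ι) := (memLp_hermiteH S).toLp _

lemma orthonormal_hermiteLp : Orthonormal ℝ (hermiteLp (ι := ι)) := by
  rw [orthonormal_iff_ite]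
  intro S T
  rw [hermiteLp, hermiteLp, inner_toLp_toLp, integral_hermiteH_mul_hermiteH]

lemma orthogonal_span_hermiteLp :
    (Submodule.span ℝ (Set.range (hermiteLp (ι := ι))))ᗮ = ⊥ := by
  rw [Submodule.eq_bot_iff]
  intro g hg
  have h0 (S : ι → ℕ) : hermCoeff g S = 0 := by
    have h := (Submodule.mem_orthogonal _ _).1 hg _ (Submodule.subset_span ⟨S, rfl⟩)
    rw [real_inner_comm, hermiteLp, ← Lp.toLp_coeFn g (Lp.memLp g), inner_toLp_toLp] at h
    exact h
  rw [Lp.eq_zero_iff_ae_eq_zero]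
  exact ae_eq_zero_of_hermCoeff_eq_zero (Lp.memLp g) h0

/-- Parseval's identity for the Hermite expansion. -/
theorem hasSum_hermCoeff_sq {f : (ι → ℝ) → ℝ} (hf : MemLp f 2 (gaussianPi ι)) :
    HasSum (fun S => hermCoeff f S ^ 2) (∫ x, f x ^ 2 ∂gaussianPi ι) := by
  have h := (HilbertBasis.mkOfOrthogonalEqBot orthonormal_hermiteLp
    (orthogonal_span_hermiteLp (ι := ι))).hasSum_inner_mul_inner (hf.toLp f) (hf.toLp f)
  simp only [HilbertBasis.coe_mkOfOrthogonalEqBot, inner_toLp_toLp] at h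
  convert! h using 2 with S
  · rw [real_inner_comm (hf.toLp f) (hermiteLp S), hermiteLp, inner_toLp_toLp, sq]
    rfl
  · ext x
    rw [sq]

/-- The truncation `Σ_{|S| ≤ d} f̂(S) H_S` of a Hermite expansion. -/
def hermiteTrunc (d : ℕ) (f : (ι → ℝ) → ℝ) : MvPolynomial ι ℝ :=
  ∑ S ∈ (Fintype.piFinset fun _ : ι => Finset.range (d + 1)) with ∑ i, S i ≤ d,
    hermCoeff f S • mvHermite S

lemma totalDegree_hermiteTrunc_le (d : ℕ) (f : (ι → ℝ) → ℝ) :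
    (hermiteTrunc d f).totalDegree ≤ d :=
  totalDegree_finsetSum_le fun S hS => (totalDegree_smul_le _ _).trans <|
    (totalDegree_mvHermite_le S).trans (Finset.mem_filter.1 hS).2

lemma eval_hermiteTrunc (d : ℕ) (f : (ι → ℝ) → ℝ) (x : ι → ℝ) :
    eval x (hermiteTrunc d f) =
      ∑ S ∈ (Fintype.piFinset fun _ : ι => Finset.range (d + 1)) with ∑ i, S i ≤ d,
        hermCoeff f S * hermiteH S x := by
  simp [hermiteTrunc, eval_mvHermite, smul_eval]

lemma memLp_eval_hermiteTrunc (d : ℕ) (f : (ι → ℝ) → ℝ) :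
    MemLp (fun x => eval x (hermiteTrunc d f)) 2 (gaussianPi ι) := by
  simp_rw [eval_hermiteTrunc]
  exact memLp_finsetSum _ fun S _ => (memLp_hermiteH S).const_mul _

lemma hermCoeff_eval_hermiteTrunc (d : ℕ) (f : (ι → ℝ) → ℝ) (T : ι → ℕ) :
    hermCoeff (fun x => eval x (hermiteTrunc d f)) T =
      if ∑ i, T i ≤ d then hermCoeff f T else 0 := by
  have hmem : T ∈ {S ∈ (Fintype.piFinset fun _ : ι => Finset.range (d + 1)) | ∑ i, S i ≤ d} ↔
      ∑ i, T i ≤ d := by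
    simp only [Finset.mem_filter, Fintype.mem_piFinset, Finset.mem_range, and_iff_right_iff_imp,
      Nat.lt_succ_iff]
    exact fun h i => (Finset.single_le_sum (fun _ _ => Nat.zero_le _) (Finset.mem_univ i)).trans h
  rw [hermCoeff]
  simp_rw [eval_hermiteTrunc, Finset.sum_mul, mul_assoc]
  rw [integral_finsetSum _ fun S _ => (integrable_hermiteH_mul_hermiteH S T).const_mul _]
  simp_rw [integral_const_mul, integral_hermiteH_mul_hermiteH, mul_ite, mul_one, mul_zero]
  rw [Finset.sum_ite_eq']
  simp_rw [hmem]

/-- The squared `L²` error of Hermite truncation is the weight above the cutoff. -/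
theorem hasSum_sq_sub_hermiteTrunc (d : ℕ) {f : (ι → ℝ) → ℝ} (hf : MemLp f 2 (gaussianPi ι)) :
    HasSum (fun S : ι → ℕ => if d < ∑ i, S i then hermCoeff f S ^ 2 else 0)
      (∫ x, (f x - eval x (hermiteTrunc d f)) ^ 2 ∂gaussianPi ι) := by
  have hp := memLp_eval_hermiteTrunc d f
  convert! hasSum_hermCoeff_sq (hf.sub hp) using 1
  ext S
  have h : hermCoeff (f - fun x => eval x (hermiteTrunc d f)) S =
      hermCoeff f S - if ∑ i, S i ≤ d then hermCoeff f S else 0 := by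
    rw [← hermCoeff_eval_hermiteTrunc, hermCoeff, hermCoeff, hermCoeff,
      ← integral_sub (integrable_mul_hermiteH hf S) (integrable_mul_hermiteH hp S)]
    simp_rw [Pi.sub_apply, sub_mul]
  rw [h]
  by_cases hS : ∑ i, S i ≤ d
  · simp [hS, hS.not_gt]
  · simp [hS, not_le.1 hS]

lemma memLp_basisVec_comp {k : ℕ} {h : (ι → ℝ) → Fin k} (hmeas : Measurable h) (j : Fin k) :
    MemLp (fun x => basisVec (h x) j) 2 (gaussianPi ι) := by
  have hm : Measurable fun i : Fin k => basisVec i j := measurable_of_finite _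
  refine MemLp.of_bound (hm.comp hmeas).aestronglyMeasurable 1 (ae_of_all _ fun x => ?_)
  by_cases hj : j = h x <;> simp [basisVec, hj]

lemma integrable_sq_basisVec_sub_hermiteTrunc (d : ℕ) {k : ℕ} {h : (ι → ℝ) → Fin k}
    (hmeas : Measurable h) (j : Fin k) :
    Integrable (fun x => (basisVec (h x) j -
      eval x (hermiteTrunc d fun y => basisVec (h y) j)) ^ 2) (gaussianPi ι) :=
  ((memLp_basisVec_comp hmeas j).sub (memLp_eval_hermiteTrunc d _)).integrable_sq

lemma integral_sum_sq_sub_hermiteTrunc (d : ℕ) {k : ℕ} {h : (ι → ℝ) → Fin k}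
    (hmeas : Measurable h) :
    ∫ x, ∑ j, (basisVec (h x) j - eval x (hermiteTrunc d fun y => basisVec (h y) j)) ^ 2
      ∂gaussianPi ι = wAbove d fun x => basisVec (h x) := by
  have hs := hasSum_sum (s := Finset.univ) fun j _ =>
    hasSum_sq_sub_hermiteTrunc d (memLp_basisVec_comp hmeas j)
  rw [integral_finsetSum _ fun j _ => integrable_sq_basisVec_sub_hermiteTrunc d hmeas j,
    ← hs.tsum_eq, wAbove]
  congr with S
  split_ifs <;> simp

/-- The thresholds `p_j = Σ_{|S| ≤ d} f̂_j(S) H_S - 1/2`. -/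
def hermiteThreshold {k : ℕ} (d : ℕ) (h : (ι → ℝ) → Fin k) (j : Fin k) : MvPolynomial ι ℝ :=
  hermiteTrunc d (fun y => basisVec (h y) j) - C (1 / 2)

lemma totalDegree_hermiteThreshold_le {k : ℕ} (d : ℕ) (h : (ι → ℝ) → Fin k) (j : Fin k) :
    (hermiteThreshold d h j).totalDegree ≤ d :=
  (totalDegree_sub_C_le _ _).trans (totalDegree_hermiteTrunc_le d _)

lemma eval_hermiteThreshold {k : ℕ} (d : ℕ) (h : (ι → ℝ) → Fin k) (j : Fin k) (x : ι → ℝ) :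
    eval x (hermiteThreshold d h j) =
      eval x (hermiteTrunc d fun y => basisVec (h y) j) - 1 / 2 := by
  simp [hermiteThreshold]

lemma hermiteThreshold_pos_iff {k : ℕ} {d : ℕ} {h : (ι → ℝ) → Fin k} {x : ι → ℝ}
    (hx : ∑ j, (basisVec (h x) j - eval x (hermiteTrunc d fun y => basisVec (h y) j)) ^ 2 < 1 / 4)
    (j : Fin k) : 0 < eval x (hermiteThreshold d h j) ↔ j = h x := by
  have hj := (Finset.single_le_sum (fun i _ => sq_nonneg _) (Finset.mem_univ j)).trans_lt hx
  rw [eval_hermiteThreshold]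
  generalize eval x (hermiteTrunc d fun y => basisVec (h y) j) = e at hj
  by_cases hjx : j = h x
  · simp only [basisVec, hjx, if_true, iff_true] at hj ⊢
    nlinarith
  · simp only [basisVec, hjx, if_false, iff_false] at hj ⊢
    nlinarith

lemma measure_le_four_mul_wAbove (d : ℕ) {k : ℕ} {h : (ι → ℝ) → Fin k} (hmeas : Measurable h)
    {s : Set (ι → ℝ)}
    (hs : ∀ x, (∀ j, 0 < eval x (hermiteThreshold d h j) ↔ j = h x) → x ∉ s) :
    (gaussianPi ι s).toReal ≤ 4 * wAbove d fun x => basisVec (h x) := by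
  have hsub : s ⊆ {x | 1 / 4 ≤
      ∑ j, (basisVec (h x) j - eval x (hermiteTrunc d fun y => basisVec (h y) j)) ^ 2} :=
    fun x hx => not_lt.1 fun hlt => hs x (hermiteThreshold_pos_iff hlt) hx
  have hmarkov := mul_meas_ge_le_integral_of_nonneg (μ := gaussianPi ι)
    (ae_of_all _ fun x => Finset.sum_nonneg fun j _ => sq_nonneg
      (basisVec (h x) j - eval x (hermiteTrunc d fun y => basisVec (h y) j)))
    (integrable_finsetSum Finset.univ fun j _ =>
      integrable_sq_basisVec_sub_hermiteTrunc d hmeas j) (1 / 4)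
  rw [integral_sum_sq_sub_hermiteTrunc d hmeas] at hmarkov
  have := measureReal_mono (μ := gaussianPi ι) hsub
  simp only [Measure.real] at this hmarkov
  linarith

lemma ptf_eq_of_forall_pos_iff {σ : Type*} {k : ℕ} [NeZero k] {p : Fin k → MvPolynomial σ ℝ} {x : σ → ℝ}
    {j : Fin k} (hj : ∀ i, 0 < eval x (p i) ↔ i = j) : ptf p x = j := by
  have hex : ∃ j, 0 < eval x (p j) ∧ ∀ i, i ≠ j → eval x (p i) ≤ 0 :=
    ⟨j, (hj j).2 rfl, fun i hi => not_lt.1 fun h => hi ((hj i).1 h)⟩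
  rw [ptf, dif_pos hex]
  exact (hj _).1 hex.choose_spec.1

lemma wAbove_nonneg {k : ℕ} (d : ℕ) (f : (ι → ℝ) → Fin k → ℝ) : 0 ≤ wAbove d f :=
  tsum_nonneg fun S => by split_ifs <;> positivity

end GaussNS

open GaussNS

/-- If `h : ℝⁿ → [k]` has `W^{>d}[h] ≤ ε`, then there is a degree-`d`
multivariate PTF `g` with `Pr[g ≠ h] ≤ k² ε` and `Pr[Collision(g)] ≤ k² ε`. -/
theorem stmt4 {n k d : ℕ} [NeZero k] (ε : ℝ)
    (h : (Fin n → ℝ) → Fin k) (hmeas : Measurable h)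
    (hW : wAbove d (fun x => basisVec (h x)) ≤ ε) :
    ∃ p : Fin k → MvPolynomial (Fin n) ℝ,
      (∀ i, (p i).totalDegree ≤ d) ∧
      ((gaussianPi (Fin n)) {x | ptf p x ≠ h x}).toReal ≤ k ^ 2 * ε ∧
      ((gaussianPi (Fin n)) (collisionSet p)).toReal ≤ k ^ 2 * ε := by
  have h0 := (wAbove_nonneg d fun x => basisVec (h x)).trans hW
  obtain hk | hk : k = 1 ∨ 2 ≤ k := by
    have := NeZero.pos k
    omega
  · subst hk
    refine ⟨fun _ => 1, by simp, ?_, ?_⟩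
    · simpa [show ∀ x, ptf (fun _ => 1) x = h x from fun x => Subsingleton.elim _ _] using h0
    · simpa [collisionSet, ExistsUnique, Subsingleton.elim _ (0 : Fin 1)] using h0
  · have hk2 : (4 : ℝ) ≤ k ^ 2 := by
      have : (2 : ℝ) ≤ k := by exact_mod_cast hk
      nlinarith
    have hle : 4 * wAbove d (fun x => basisVec (h x)) ≤ k ^ 2 * ε :=
      mul_le_mul hk2 hW (wAbove_nonneg _ _) (by positivity)
    refine ⟨hermiteThreshold d h, totalDegree_hermiteThreshold_le d h, ?_, ?_⟩
    · refine (measure_le_four_mul_wAbove d hmeas fun x hx => ?_).trans hle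
      simpa using ptf_eq_of_forall_pos_iff hx
    · refine (measure_le_four_mul_wAbove d hmeas fun x hx => ?_).trans hle
      simp [collisionSet, hx]
end
end
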